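/- Let S be a carpet in S² whose peripheral circles form a family of uniform quasicircles, and let Γ be a path family in S². If mod_S(Γ) = 0, then mod(Γ) = 0. -/

import Mathlib

open Set Metric

noncomputable section

/-- Level-`n` approximation `Q_n` of the standard `1/p`-Sierpiński carpet in `ℂ ≅ ℝ²`:
`Q_0` is the closed unit square, and `Q_{n+1}` is the union of the images of `Q_n` under
the `p² - 1` contractions `z ↦ (z + i + j·√-1)/p` with `(i,j)` ranging over all non-middle
positions; this is the usual subdivide-and-remove-middle-squares construction. -/
def carpetApprox (p : ℕ) : ℕ → Set ℂ
  | 0 => {z : ℂ | z.re ∈ Set.Icc (0:ℝ) 1 ∧ z.im ∈ Set.Icc (0:ℝ) 1}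
  | n + 1 =>
      ⋃ (i : ℕ) (j : ℕ) (_ : i < p) (_ : j < p)
        (_ : ¬(i = (p - 1) / 2 ∧ j = (p - 1) / 2)),
        (fun z : ℂ => (z + (i : ℂ) + (j : ℂ) * Complex.I) / (p : ℂ)) '' carpetApprox p n

/-- The standard `1/p`-Sierpiński carpet `S_p ⊆ ℝ² ≅ ℂ`. -/
def sierpinskiCarpet (p : ℕ) : Set ℂ := ⋂ n, carpetApprox p n

/-- `η : [0,∞) → [0,∞)` is a (self-)homeomorphism of `[0,∞)`: it is continuous, strictly
increasing on `[0,∞)`, fixes `0` and maps `[0,∞)` onto `[0,∞)`. -/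
def IsQSControl (η : ℝ → ℝ) : Prop :=
  ContinuousOn η (Set.Ici 0) ∧ StrictMonoOn η (Set.Ici 0) ∧ η 0 = 0 ∧
    Set.SurjOn η (Set.Ici 0) (Set.Ici 0)

/-- A map `f` between metric spaces is quasisymmetric: for some homeomorphism
`η : [0,∞) → [0,∞)` one has `d(f u, f v) ≤ η(d(u,v)/d(u,w)) · d(f u, f w)` for all `u,v,w`
with `u ≠ w`. -/
def IsQSMap {X Y : Type*} [MetricSpace X] [MetricSpace Y] (f : X → Y) : Prop :=
  ∃ η : ℝ → ℝ, IsQSControl η ∧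
    ∀ u v w : X, u ≠ w → dist (f u) (f v) ≤ η (dist u v / dist u w) * dist (f u) (f w)

/-- The boundary of the axis-parallel closed square with lower-left corner `c` and
side length `l`. -/
def squareBoundary (c : ℂ) (l : ℝ) : Set ℂ :=
  {z : ℂ | max |z.re - (c.re + l / 2)| |z.im - (c.im + l / 2)| = l / 2}

/-- The outer square `O = ∂([0,1]×[0,1])`. -/
def outerSquare : Set ℂ := squareBoundary 0 1

/-- The middle square `M = ∂([(p-1)/(2p),(p+1)/(2p)]²)`. -/
def middleSquare (p : ℕ) : Set ℂ :=
  squareBoundary ((((p : ℝ) - 1) / (2 * p) : ℝ) * (1 + Complex.I)) (1 / p)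

end

open MeasureTheory Filter Topology
open scoped ENNReal

noncomputable section

/-- The unit sphere `S² = {x ∈ ℝ³ : |x| = 1}`, with the metric induced from `ℝ³`. -/
def Sphere2 : Set (EuclideanSpace ℝ (Fin 3)) := Metric.sphere 0 1

/-- The `2`-dimensional Hausdorff measure `σ` on `S²`. -/
def sphereMeasure : Measure ↥Sphere2 := μH[2]

/-- A path in `S²`: a continuous map of a finite interval (of one of the four kinds
`[a,b]`, `[a,b)`, `(a,b]`, `(a,b)` with `a < b`) into `S²`. -/
structure SpherePath where
  /-- The parameter interval. -/
  I : Set ℝ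
  /-- The parameter set is a finite interval. -/
  hI : ∃ a b : ℝ, a < b ∧
    (I = Set.Icc a b ∨ I = Set.Ico a b ∨ I = Set.Ioc a b ∨ I = Set.Ioo a b)
  /-- The parametrizing map. -/
  toFun : ℝ → ↥Sphere2
  /-- Continuity on the parameter interval. -/
  cont : ContinuousOn toFun I

/-- The image of a path. -/
def SpherePath.image (γ : SpherePath) : Set ↥Sphere2 := γ.toFun '' γ.I

/-- A path is locally rectifiable if it has finite length (total variation) on every
compact subinterval of its parameter interval. -/
def SpherePath.LocRectifiable (γ : SpherePath) : Prop :=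
  ∀ a b : ℝ, Set.Icc a b ⊆ γ.I → eVariationOn γ.toFun (Set.Icc a b) < ⊤

/-- The arclength integral `∫ ρ ds` of a density `ρ` over the restriction of the curve
`f` to `[a,b]`, computed via the arclength parametrization: if `s(t)` denotes the length
of `f|[a,t]` and `L` the length of `f|[a,b]`, this is `∫₀ᴸ ρ(f(t(u))) du` where
`t(u) = inf{t ∈ [a,b] : s(t) ≥ u}`. -/
def arcIntegralOn (ρ : ↥Sphere2 → ℝ≥0∞) (f : ℝ → ↥Sphere2) (a b : ℝ) : ℝ≥0∞ :=
  ∫⁻ u in Set.Ico (0 : ℝ) (eVariationOn f (Set.Icc a b)).toReal,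
    ρ (f (sInf {t | t ∈ Set.Icc a b ∧
      ENNReal.ofReal u ≤ eVariationOn f (Set.Icc a t)}))

/-- The arclength integral `∫_γ ρ ds` of a density `ρ` along a path `γ`, defined as the
supremum of the arclength integrals over all compact subintervals of the parameter
interval. -/
def SpherePath.lineIntegral (γ : SpherePath) (ρ : ↥Sphere2 → ℝ≥0∞) : ℝ≥0∞ :=
  ⨆ (a : ℝ) (b : ℝ) (_ : Set.Icc a b ⊆ γ.I), arcIntegralOn ρ γ.toFun a b

/-- The conformal modulus `mod(Γ)` of a family of paths in `S²`: the infimum of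
`∫ ρ² dσ` over all Borel densities `ρ : S² → [0,∞]` with `∫_γ ρ ds ≥ 1` for every
locally rectifiable `γ ∈ Γ`. -/
def conformalModulus (Γ : Set SpherePath) : ℝ≥0∞ :=
  ⨅ (ρ : ↥Sphere2 → ℝ≥0∞) (_ : Measurable ρ)
    (_ : ∀ γ ∈ Γ, γ.LocRectifiable → 1 ≤ γ.lineIntegral ρ),
    ∫⁻ x, ρ x ^ 2 ∂sphereMeasure

/-- A carpet in `S²`: a subset homeomorphic to the standard Sierpiński carpet `S_3`. -/
def IsCarpet (S : Set ↥Sphere2) : Prop := Nonempty (↥S ≃ₜ ↥(sierpinskiCarpet 3))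

/-- A peripheral circle of a carpet `S ⊆ S²`: a Jordan curve `C ⊆ S` (a subset
homeomorphic to a circle) whose complement `S ∖ C` in `S` is connected. -/
def IsPeripheralCircle (S C : Set ↥Sphere2) : Prop :=
  C ⊆ S ∧ Nonempty (↥C ≃ₜ ↥(Metric.sphere (0 : ℂ) 1)) ∧ IsConnected (S \ C)

/-- `Σ_{C : γ ∩ C ≠ ∅} ρ(C)`: the total mass of the peripheral circles of `S` met by the
path `γ`. -/
def pathMassSum (S : Set ↥Sphere2) (ρ : Set ↥Sphere2 → ℝ≥0∞) (γ : SpherePath) : ℝ≥0∞ :=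
  ∑' C : {C : Set ↥Sphere2 // IsPeripheralCircle S C ∧ (γ.image ∩ C).Nonempty}, ρ C

/-- A mass distribution `ρ` on the peripheral circles of `S` is admissible for the carpet
modulus `mod_S(Γ)` if there is an exceptional family `Γ₀ ⊆ Γ` of conformal modulus zero
such that every `γ ∈ Γ ∖ Γ₀` meets peripheral circles of total mass at least `1`. -/
def CarpetAdmissible (S : Set ↥Sphere2) (Γ : Set SpherePath)
    (ρ : Set ↥Sphere2 → ℝ≥0∞) : Prop :=
  ∃ Γ₀ : Set SpherePath, Γ₀ ⊆ Γ ∧ conformalModulus Γ₀ = 0 ∧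
    ∀ γ ∈ Γ \ Γ₀, 1 ≤ pathMassSum S ρ γ

/-- The total mass `Σ_i ρ(C_i)²` of a mass distribution on the peripheral circles of a
carpet `S`. -/
def carpetMass (S : Set ↥Sphere2) (ρ : Set ↥Sphere2 → ℝ≥0∞) : ℝ≥0∞ :=
  ∑' C : {C : Set ↥Sphere2 // IsPeripheralCircle S C}, ρ C ^ 2

/-- The carpet modulus `mod_S(Γ)` of a path family `Γ` with respect to a carpet
`S ⊆ S²`. -/
def carpetModulus (S : Set ↥Sphere2) (Γ : Set SpherePath) : ℝ≥0∞ :=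
  ⨅ (ρ : Set ↥Sphere2 → ℝ≥0∞) (_ : CarpetAdmissible S Γ ρ), carpetMass S ρ

/-- A family of Jordan curves in `S²` consists of uniform quasicircles if there is a
single control function `η` such that each curve in the family is the image of the
Euclidean unit circle under an `η`-quasisymmetric map. -/
def UniformQuasicircles (𝒞 : Set (Set ↥Sphere2)) : Prop :=
  ∃ η : ℝ → ℝ, IsQSControl η ∧ ∀ C ∈ 𝒞,
    ∃ f : ↥(Metric.sphere (0 : ℂ) 1) → ↥Sphere2, Set.range f = C ∧
      Function.Injective f ∧
      ∀ u v w : ↥(Metric.sphere (0 : ℂ) 1), u ≠ w →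
        dist (f u) (f v) ≤ η (dist u v / dist u w) * dist (f u) (f w)

end

open scoped unitInterval ComplexConjugate

/-- The identity of a circle has no continuous logarithm. -/
theorem not_exists_log_on_circle (a : ℂ) {r : ℝ} (hr : 0 < r) (φ : ℂ → ℂ)
    (hφ : ContinuousOn φ (sphere a r)) (h : ∀ z ∈ sphere a r, Complex.exp (φ z) = z - a) :
    False := by
  have hmem : ∀ t : ℝ, circleMap a r t ∈ sphere a r := fun t => circleMap_mem_sphere a hr.le t
  have hc : Continuous fun t : ℝ => φ (circleMap a r t) - t * Complex.I :=
    (hφ.comp_continuous (continuous_circleMap a r) hmem).sub (by fun_prop)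
  have hexp : ∀ t : ℝ, Complex.exp (φ (circleMap a r t) - t * Complex.I) = r := by
    intro t
    rw [Complex.exp_sub, h _ (hmem t), circleMap_sub_center, circleMap_zero]
    field_simp [Complex.exp_ne_zero]
  have hr' : (r : ℂ) ≠ 0 := by exact_mod_cast hr.ne'
  have hconst : ∀ t : ℝ, φ (circleMap a r t) - t * Complex.I =
      φ (circleMap a r 0) - (0 : ℝ) * Complex.I := by
    intro t
    have := Complex.isCoveringMap_exp.eq_of_comp_eq (A := ℝ)
      (g₁ := fun t : ℝ => φ (circleMap a r t) - t * Complex.I)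
      (g₂ := fun _ : ℝ => φ (circleMap a r 0) - (0 : ℝ) * Complex.I) hc continuous_const
      (by funext t; simp only [Function.comp, Subtype.mk.injEq]; rw [hexp, hexp]) 0 rfl
    exact congrFun this t
  have h2 := hconst (2 * Real.pi)
  have : circleMap a r (2 * Real.pi) = circleMap a r 0 := by
    simpa using periodic_circleMap a r 0
  rw [this] at h2
  have : (2 * Real.pi : ℂ) * Complex.I = 0 := by
    push_cast at h2
    linear_combination -h2
  exact Complex.two_pi_I_ne_zero this

/-- A nowhere vanishing continuous function on the plane has a continuous logarithm. -/
theorem exists_log_of_ne_zero (G : ℂ → ℂ) (hG : Continuous G) (h0 : ∀ z, G z ≠ 0) :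
    ∃ φ : ℂ → ℂ, Continuous φ ∧ ∀ z, Complex.exp (φ z) = G z := by
  obtain ⟨F, hF, -⟩ := Complex.isCoveringMap_exp.existsUnique_continuousMap_lifts
    (A := ℂ) (⟨fun z => ⟨G z, h0 z⟩, by fun_prop⟩ : C(ℂ, {z : ℂ // z ≠ 0})) (a₀ := 0)
    (e₀ := Complex.log (G 0)) (by ext; simp [Complex.exp_log (h0 0)])
  refine ⟨F, F.continuous, fun z => ?_⟩
  have := congrFun hF.2 z
  simpa using congrArg Subtype.val this

/-- A bounded plane domain does not retract onto a closed set containing its boundary. -/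
theorem not_retract_onto_boundary {D C : Set ℂ} (hDo : IsOpen D) (hD : D.Nonempty)
    (hb : Bornology.IsBounded D) (hDC : Disjoint D C)
    (hcl : closure D ⊆ D ∪ C) (R : ℂ → ℂ) (hR : ContinuousOn R (D ∪ C))
    (hmaps : MapsTo R (D ∪ C) C) (hid : ∀ z ∈ C, R z = z) : False := by
  classical
  obtain ⟨p, hp⟩ := hD
  have hfr : frontier D ⊆ C := by
    intro z hz
    rcases hcl hz.1 with h | h
    · exact absurd h (by rw [hDo.frontier_eq] at hz; exact hz.2)
    · exact h
  have hG : Continuous (D.piecewise R id) := by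
    refine continuous_piecewise (fun z hz => hid z (hfr hz)) (hR.mono hcl) continuousOn_id
  have hne : ∀ z, D.piecewise R id z - p ≠ 0 := by
    intro z hz
    rw [sub_eq_zero] at hz
    by_cases hzD : z ∈ D
    · rw [piecewise_eq_of_mem _ _ _ hzD] at hz
      exact hDC.le_bot ⟨hp, hz ▸ hmaps (Or.inl hzD)⟩
    · rw [piecewise_eq_of_notMem _ _ _ hzD] at hz
      exact hzD ((show z = p from hz) ▸ hp)
  obtain ⟨φ, hφ, hexp⟩ := exists_log_of_ne_zero _ (hG.sub continuous_const) hne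
  obtain ⟨r, hr, hball⟩ := hb.subset_ball_lt 0 p
  refine not_exists_log_on_circle p hr φ hφ.continuousOn fun z hz => ?_
  have hzD : z ∉ D := fun h => by
    have := hball h
    rw [mem_ball, mem_sphere.1 hz] at this
    exact lt_irrefl _ this
  rw [hexp, Pi.sub_apply, piecewise_eq_of_notMem _ _ _ hzD, id]

/-- On the complement of a path from `a` to `b` the quotient `(z - a) / (z - b)` has, up to
a constant factor, a continuous logarithm. -/
theorem exists_log_off_path (α : C(I, ℂ)) :
    ∃ φ : ℂ → ℂ, ∃ k : ℂ, ContinuousOn φ (range α)ᶜ ∧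
      ∀ z ∈ (range α)ᶜ, Complex.exp (φ z) = k * ((z - α 0) / (z - α 1)) := by
  classical
  have hK : IsCompact (range α) := isCompact_range α.continuous
  obtain ⟨z₀, hz₀⟩ : ∃ z₀, z₀ ∉ range α := by
    by_contra! hcon
    exact noncompact_univ ℂ ((eq_univ_of_forall hcon) ▸ hK)
  have hne : ∀ t, ∀ z ∈ (range α)ᶜ, z - α t ≠ 0 := fun t z hz h =>
    hz ⟨t, (sub_eq_zero.1 h).symm⟩
  let X := ((range α)ᶜ : Set ℂ)
  let H : C(I × X, {z : ℂ // z ≠ 0}) :=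
    ⟨fun q => ⟨((q.2 : ℂ) - α (σ q.1)) * (z₀ - α 1) / ((z₀ - α (σ q.1)) * ((q.2 : ℂ) - α 1)),
      div_ne_zero (mul_ne_zero (hne _ _ q.2.2) (hne _ _ hz₀))
        (mul_ne_zero (hne _ _ hz₀) (hne _ _ q.2.2))⟩, by
      refine Continuous.subtype_mk (Continuous.div (by fun_prop) (by fun_prop) fun q => ?_) _
      exact mul_ne_zero (hne _ _ hz₀) (hne _ _ q.2.2)⟩
  have H0 : ∀ x : X, H (0, x) = ⟨Complex.exp ((0 : C(X, ℂ)) x), Complex.exp_ne_zero _⟩ := by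
    intro x
    ext
    have h1 := hne 1 _ x.2
    have h2 := hne 1 _ hz₀
    simp only [H, ContinuousMap.coe_mk, unitInterval.symm_zero, ContinuousMap.zero_apply,
      Complex.exp_zero]
    field_simp
  let L := Complex.isCoveringMap_exp.liftHomotopy H 0 H0
  have hL : ∀ q, Complex.exp (L q) = H q := fun q => by
    have := congrFun (Complex.isCoveringMap_exp.liftHomotopy_lifts H 0 H0) q
    exact congrArg Subtype.val this
  refine ⟨fun z => if h : z ∈ (range α)ᶜ then L (1, ⟨z, h⟩) else 0,
    (z₀ - α 1) / (z₀ - α 0), ?_, ?_⟩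
  · rw [continuousOn_iff_continuous_domRestrict]
    have : Continuous fun x : X => L (1, x) := by fun_prop
    convert this using 2 with x
    exact dif_pos x.2
  · intro z hz
    simp only [dif_pos hz, hL]
    have h1 := hne 1 _ hz
    have h2 := hne 0 _ hz₀
    simp only [H, ContinuousMap.coe_mk, unitInterval.symm_one]
    field_simp

/-- Two plane paths with common end points which are otherwise disjoint separate the plane. -/
theorem not_isPreconnected_compl_of_paths (α β : C(I, ℂ)) (h0 : α 0 = β 0) (h1 : α 1 = β 1)
    (hne : α 0 ≠ α 1) (hinter : range α ∩ range β ⊆ {α 0, α 1}) :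
    ¬ IsPreconnected (range α ∪ range β)ᶜ := by
  classical
  intro hpre
  obtain ⟨φ, k, hφ, hφe⟩ := exists_log_off_path α
  obtain ⟨ψ, l, hψ, hψe⟩ := exists_log_off_path β
  rw [← h0, ← h1] at hψe
  have hKα : IsClosed (range α) := (isCompact_range α.continuous).isClosed
  have hKβ : IsClosed (range β) := (isCompact_range β.continuous).isClosed
  obtain ⟨z₀, hz₀⟩ : ((range α ∪ range β)ᶜ).Nonempty := by
    by_contra! hcon
    rw [compl_empty_iff] at hcon
    exact noncompact_univ ℂ (hcon ▸ (isCompact_range α.continuous).union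
      (isCompact_range β.continuous))
  have hα : ∀ z ∈ (range α ∪ range β)ᶜ, z ∈ (range α)ᶜ := fun z hz h => hz (Or.inl h)
  have hβ : ∀ z ∈ (range α ∪ range β)ᶜ, z ∈ (range β)ᶜ := fun z hz h => hz (Or.inr h)
  have hconst : ∀ z ∈ (range α ∪ range β)ᶜ, φ z - ψ z = φ z₀ - ψ z₀ := by
    have hval : ∀ z ∈ (range α ∪ range β)ᶜ, Complex.exp (φ z - ψ z) = k / l := by
      intro z hz
      have hza : z - α 0 ≠ 0 := fun h => hα z hz ⟨0, (sub_eq_zero.1 h).symm⟩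
      have hzb : z - α 1 ≠ 0 := fun h => hα z hz ⟨1, (sub_eq_zero.1 h).symm⟩
      rw [Complex.exp_sub, hφe z (hα z hz), hψe z (hβ z hz)]
      field_simp
    intro z hz
    have : PreconnectedSpace ↥(range α ∪ range β)ᶜ := Subtype.preconnectedSpace hpre
    have hc : Continuous fun x : ↥(range α ∪ range β)ᶜ => φ x - ψ x :=
      (continuousOn_iff_continuous_domRestrict.1 (hφ.mono hα)).sub
        (continuousOn_iff_continuous_domRestrict.1 (hψ.mono hβ))
    have := Complex.isCoveringMap_exp.eq_of_comp_eq (g₂ := fun _ => φ z₀ - ψ z₀) hc continuous_const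
      (by funext x; simp only [Function.comp, Subtype.mk.injEq]; rw [hval _ x.2, hval _ hz₀])
      ⟨z₀, hz₀⟩ rfl
    exact congrFun this ⟨z, hz⟩
  let χ : ℂ → ℂ := fun z => if z ∈ (range α)ᶜ then φ z else ψ z + (φ z₀ - ψ z₀)
  have hχβ : ∀ z ∈ (range β)ᶜ, χ z = ψ z + (φ z₀ - ψ z₀) := by
    intro z hz
    by_cases hza : z ∈ (range α)ᶜ
    · have := hconst z (fun h => h.elim hza hz)
      simp only [χ, if_pos hza]
      linear_combination this
    · simp only [χ, if_neg hza]
  have hχα : ∀ z ∈ (range α)ᶜ, χ z = φ z := fun z hz => if_pos hz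
  have hkl : ∀ z ∈ (range α)ᶜ ∪ (range β)ᶜ, Complex.exp (χ z) = k * ((z - α 0) / (z - α 1)) := by
    rintro z (hz | hz)
    · rw [hχα z hz, hφe z hz]
    · rw [hχβ z hz, Complex.exp_add, hψe z hz, Complex.exp_sub, hφe _ (hα _ hz₀),
        hψe _ (hβ _ hz₀)]
      have hza : z₀ - α 0 ≠ 0 := fun h => hα z₀ hz₀ ⟨0, (sub_eq_zero.1 h).symm⟩
      have hzb : z₀ - α 1 ≠ 0 := fun h => hα z₀ hz₀ ⟨1, (sub_eq_zero.1 h).symm⟩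
      have hl : l ≠ 0 := by
        rintro rfl
        have := hψe z₀ (hβ _ hz₀)
        rw [zero_mul] at this
        exact Complex.exp_ne_zero _ this
      field_simp
  have hχc : ContinuousOn χ ((range α)ᶜ ∪ (range β)ᶜ) := by
    have h1 : ContinuousOn χ (range α)ᶜ := hφ.congr hχα
    have h2 : ContinuousOn χ (range β)ᶜ := (hψ.add continuousOn_const).congr hχβ
    exact h1.union_of_isOpen h2 hKα.isOpen_compl hKβ.isOpen_compl
  have hk : k ≠ 0 := by
    rintro rfl
    have := hkl z₀ (Or.inl (hα _ hz₀))
    rw [zero_mul] at this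
    exact Complex.exp_ne_zero _ this
  set a := α 0
  set b := α 1
  have hd : 0 < dist a b := dist_pos.2 hne
  have hab : a - b ≠ 0 := sub_ne_zero.2 hne
  have hsph : ∀ z ∈ sphere a (dist a b / 2), z ∈ (range α)ᶜ ∪ (range β)ᶜ := by
    intro z hz
    rw [← compl_inter]
    intro h
    rcases hinter h with rfl | h
    · rw [mem_sphere, dist_self] at hz
      linarith
    · rw [mem_singleton_iff] at h
      rw [mem_sphere, h, dist_comm] at hz
      linarith
  have hslit : ∀ z ∈ sphere a (dist a b / 2), (z - b) / (a - b) ∈ Complex.slitPlane := by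
    intro z hz
    have h : ‖(z - a) / (a - b)‖ < 1 := by
      rw [norm_div, ← dist_eq_norm, ← dist_eq_norm, mem_sphere.1 hz, div_lt_one hd]
      linarith
    convert Complex.mem_slitPlane_of_norm_lt_one h using 1
    field_simp
    ring
  refine not_exists_log_on_circle a (half_pos hd)
    (fun z => χ z + Complex.log ((z - b) / (a - b)) - Complex.log (k / (a - b))) ?_ ?_
  · refine ((hχc.mono hsph).add ?_).sub continuousOn_const
    exact ContinuousOn.clog (by fun_prop) hslit
  · intro z hz
    have hzb : z - b ≠ 0 := fun h => by
      have := hslit z hz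
      rw [h, zero_div] at this
      exact Complex.zero_notMem_slitPlane this
    rw [Complex.exp_sub, Complex.exp_add, hkl z (hsph z hz),
      Complex.exp_log (Complex.slitPlane_ne_zero (hslit z hz)),
      Complex.exp_log (div_ne_zero hk hab)]
    field_simp

/-- A Jordan curve separates the plane. -/
theorem not_isPreconnected_compl_range_of_injective (c : ↥(sphere (0 : ℂ) 1) → ℂ)
    (hc : Continuous c) (hinj : Function.Injective c) : ¬ IsPreconnected (range c)ᶜ := by
  let e : ℝ → ↥(sphere (0 : ℂ) 1) := fun t =>
    ⟨Complex.exp (t * Real.pi * Complex.I), by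
      rw [mem_sphere_zero_iff_norm, show (t * Real.pi * Complex.I : ℂ) =
        ((t * Real.pi : ℝ) : ℂ) * Complex.I by push_cast; ring, Complex.norm_exp_ofReal_mul_I]⟩
  have he : Continuous e := Continuous.subtype_mk (by fun_prop) _
  have heq : ∀ s t, e s = e t → ∃ n : ℤ, s = t + 2 * n := by
    intro s t h
    obtain ⟨n, hn⟩ := Complex.exp_eq_exp_iff_exists_int.1 (congrArg Subtype.val h)
    refine ⟨n, ?_⟩
    have hpi : (Real.pi : ℂ) * Complex.I ≠ 0 := by simp [Real.pi_ne_zero]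
    have : (s : ℂ) = t + 2 * n := by
      apply mul_right_cancel₀ hpi
      linear_combination hn
    exact_mod_cast this
  have hsurj : ∀ u, ∃ t ∈ Icc (-1 : ℝ) 1, e t = u := by
    intro u
    refine ⟨Complex.arg u / Real.pi, ⟨?_, ?_⟩, ?_⟩
    · rw [le_div_iff₀ Real.pi_pos]
      linarith [Complex.neg_pi_lt_arg (u : ℂ)]
    · rw [div_le_one Real.pi_pos]
      exact Complex.arg_le_pi _
    · ext
      have hn : ‖(u : ℂ)‖ = 1 := mem_sphere_zero_iff_norm.1 u.2
      have := Complex.norm_mul_exp_arg_mul_I (u : ℂ)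
      rw [hn, Complex.ofReal_one, one_mul] at this
      simp only [e]
      have hpi : (Real.pi : ℂ) ≠ 0 := by exact_mod_cast Real.pi_ne_zero
      rw [Complex.ofReal_div, div_mul_cancel₀ _ hpi, this]
  let α : C(I, ℂ) := ⟨fun t => c (e t), by fun_prop⟩
  let β : C(I, ℂ) := ⟨fun t => c (e (-t)), by fun_prop⟩
  have hrange : range c = range α ∪ range β := by
    ext z
    constructor
    · rintro ⟨u, rfl⟩
      obtain ⟨t, ht, rfl⟩ := hsurj u
      rcases le_total 0 t with h | h
      · exact Or.inl ⟨⟨t, h, ht.2⟩, rfl⟩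
      · exact Or.inr ⟨⟨-t, by linarith, by linarith [ht.1]⟩, by simp [β]⟩
    · rintro (⟨t, rfl⟩ | ⟨t, rfl⟩)
      exacts [⟨_, rfl⟩, ⟨_, rfl⟩]
  rw [hrange]
  refine not_isPreconnected_compl_of_paths α β (by simp [α, β]) ?_ ?_ ?_
  · have : e 1 = e (-1) := by
      ext
      simp [e, Complex.exp_neg, Complex.exp_pi_mul_I]
    simpa [α, β] using congrArg c this
  · intro h
    obtain ⟨n, hn⟩ := heq _ _ (hinj h)
    have h2 : (2 * n + 1 : ℝ) = 0 := by simpa [add_comm] using hn.symm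
    have : (2 * n + 1 : ℤ) = 0 := by exact_mod_cast h2
    omega
  · rintro _ ⟨⟨s, rfl⟩, t, hst⟩
    obtain ⟨n, hn⟩ := heq _ _ (hinj hst)
    have hs := s.2
    have ht := t.2
    have h1 : (-1 : ℝ) ≤ n := by linarith [hs.2, ht.2]
    have h2 : (n : ℝ) ≤ 0 := by linarith [hs.1, ht.1]
    have h1' : (-1 : ℤ) ≤ n := by exact_mod_cast h1
    have h2' : n ≤ (0 : ℤ) := by exact_mod_cast h2
    obtain rfl | rfl : n = 0 ∨ n = -1 := by omega
    · left
      have : s = 0 := by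
        ext
        push_cast at hn
        rw [Icc.coe_zero]
        linarith [hs.1, ht.1]
      rw [this]
    · right
      have : s = 1 := by
        ext
        push_cast at hn
        rw [Icc.coe_one]
        linarith [hs.2, ht.2]
      rw [this]
      rfl

theorem isPreconnected_compl_closedBall_zero {R : ℝ} (hR : 0 < R) :
    IsPreconnected (closedBall (0 : ℂ) R)ᶜ := by
  have : (closedBall (0 : ℂ) R)ᶜ = Complex.exp '' {w | Real.log R < w.re} := by
    ext z
    simp only [mem_compl_iff, mem_closedBall, dist_zero_right, not_le, mem_image, mem_ofPred_eq]
    constructor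
    · intro h
      have hz : z ≠ 0 := norm_pos_iff.1 (hR.trans h)
      exact ⟨Complex.log z, by rw [Complex.log_re]; exact Real.log_lt_log hR h,
        Complex.exp_log hz⟩
    · rintro ⟨w, hw, rfl⟩
      rw [Complex.norm_exp]
      exact (Real.log_lt_iff_lt_exp hR).1 hw
  rw [this]
  exact (convex_halfSpace_re_gt _).isPreconnected.image _ Complex.continuous_exp.continuousOn

/-- The complement of a plane Jordan curve has a bounded component. -/
theorem exists_bounded_component (c : ↥(sphere (0 : ℂ) 1) → ℂ)
    (hc : Continuous c) (hinj : Function.Injective c) :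
    ∃ D : Set ℂ, IsOpen D ∧ IsConnected D ∧ Bornology.IsBounded D ∧ Disjoint D (range c) ∧
      closure D ⊆ D ∪ range c := by
  have hK : IsCompact (range c) := isCompact_range hc
  obtain ⟨R, hR, hball⟩ := hK.isBounded.subset_ball_lt 0 0
  have hext : (closedBall (0 : ℂ) R)ᶜ ⊆ (range c)ᶜ :=
    compl_subset_compl.2 (hball.trans ball_subset_closedBall)
  set U := (range c)ᶜ with hU
  have hUo : IsOpen U := hK.isClosed.isOpen_compl
  obtain ⟨w, hw⟩ : ((closedBall (0 : ℂ) R)ᶜ).Nonempty := by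
    by_contra! hcon
    rw [compl_empty_iff] at hcon
    exact noncompact_univ ℂ (hcon ▸ isCompact_closedBall _ _)
  have hW : (closedBall (0 : ℂ) R)ᶜ ⊆ connectedComponentIn U w :=
    (isPreconnected_compl_closedBall_zero hR).subset_connectedComponentIn hw hext
  obtain ⟨z, hzU, hz⟩ : ∃ z ∈ U, z ∉ connectedComponentIn U w := by
    by_contra! hcon
    apply not_isPreconnected_compl_range_of_injective c hc hinj
    rw [← hU, ← (connectedComponentIn_subset U w).antisymm hcon]
    exact isPreconnected_connectedComponentIn
  have hdisj : Disjoint (connectedComponentIn U z) (connectedComponentIn U w) := by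
    rw [disjoint_left]
    intro y hy hy'
    rw [connectedComponentIn_eq hy', ← connectedComponentIn_eq hy] at hz
    exact hz (mem_connectedComponentIn hzU)
  refine ⟨connectedComponentIn U z, hUo.connectedComponentIn,
    isConnected_connectedComponentIn_iff.2 hzU, ?_, ?_, ?_⟩
  · refine (isBounded_closedBall (x := (0 : ℂ)) (r := R)).subset fun y hy => ?_
    by_contra hcon
    exact hdisj.le_bot ⟨hy, hW hcon⟩
  · rw [disjoint_left]
    exact fun y hy => connectedComponentIn_subset _ _ hy
  · intro x hx
    by_cases hxU : x ∈ U
    · left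
      obtain ⟨y, hy, hy'⟩ := mem_closure_iff.1 hx _ (hUo.connectedComponentIn (x := x))
        (mem_connectedComponentIn hxU)
      rw [connectedComponentIn_eq hy', ← connectedComponentIn_eq hy]
      exact mem_connectedComponentIn hxU
    · exact Or.inr (not_not.1 hxU)

/-- `D` is a complementary domain of `C`: a nonempty connected open set disjoint from `C` all of
whose boundary points lie in `C`. -/
structure IsComplementaryDomain (C D : Set ↥Sphere2) : Prop where
  isOpen : IsOpen D
  isConnected : IsConnected D
  disjoint : Disjoint D C
  closure_subset : closure D ⊆ D ∪ C

theorem IsComplementaryDomain.subset_of_isPreconnected {C D P : Set ↥Sphere2}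
    (hD : IsComplementaryDomain C D) (hP : IsPreconnected P) (hPC : Disjoint P C)
    (hPD : (P ∩ D).Nonempty) : P ⊆ D := by
  refine hP.subset_of_closure_inter_subset hD.isOpen hPD fun x hx => ?_
  exact (hD.closure_subset hx.1).resolve_right fun h => hPC.le_bot ⟨hx.2, h⟩

theorem exists_sphere_chart (q : ↥Sphere2) :
    ∃ E : OpenPartialHomeomorph ↥Sphere2 ℂ, E.source = {q}ᶜ ∧ E.target = univ := by
  have : Fact (Module.finrank ℝ (EuclideanSpace ℝ (Fin 3)) = 2 + 1) := ⟨by simp⟩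
  let E₀ : OpenPartialHomeomorph ↥Sphere2 (EuclideanSpace ℝ (Fin 2)) :=
    stereographic' (E := EuclideanSpace ℝ (Fin 3)) 2 q
  have hs : E₀.source = {q}ᶜ := stereographic'_source (E := EuclideanSpace ℝ (Fin 3)) q
  have ht : E₀.target = univ := stereographic'_target (E := EuclideanSpace ℝ (Fin 3)) q
  let T : EuclideanSpace ℝ (Fin 2) ≃ₜ ℂ := Complex.orthonormalBasisOneI.repr.symm.toHomeomorph
  refine ⟨E₀.trans T.toOpenPartialHomeomorph, ?_, ?_⟩
  · rw [OpenPartialHomeomorph.trans_source, hs]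
    simp
  · rw [OpenPartialHomeomorph.trans_target, ht]
    simp

/-- A Jordan curve on the sphere has a complementary domain avoiding a given point off the
curve. -/
theorem exists_isComplementaryDomain (f : ↥(sphere (0 : ℂ) 1) → ↥Sphere2)
    (hf : Continuous f) (hinj : Function.Injective f) {q : ↥Sphere2} (hq : q ∉ range f) :
    ∃ D, IsComplementaryDomain (range f) D ∧ q ∉ D := by
  obtain ⟨E, hEs, hEt⟩ := exists_sphere_chart q
  have hfs : ∀ u, f u ∈ E.source := fun u => by
    rw [hEs]
    exact fun h => hq ⟨u, h⟩
  obtain ⟨D, hDo, hDc, hDb, hDd, hDcl⟩ := exists_bounded_component (fun u => E (f u))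
    (E.continuousOn.comp_continuous hf hfs)
    (fun u v huv => hinj (E.injOn (hfs u) (hfs v) huv))
  have hsymm : Continuous E.symm := by
    rw [← continuousOn_univ, ← hEt]
    exact E.continuousOn_symm
  have hcomp : IsCompact (D ∪ range fun u => E (f u)) := by
    refine isCompact_of_isClosed_isBounded ?_ (hDb.union ?_)
    · refine isClosed_of_closure_subset ?_
      rw [closure_union, (isCompact_range _).isClosed.closure_eq]
      · exact union_subset hDcl subset_union_right
      · exact E.continuousOn.comp_continuous hf hfs
    · exact (isCompact_range (E.continuousOn.comp_continuous hf hfs)).isBounded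
  have himg : E.symm '' (D ∪ range fun u => E (f u)) = E.symm '' D ∪ range f := by
    rw [image_union, ← range_comp]
    congr 2
    funext u
    exact E.left_inv (hfs u)
  refine ⟨E.symm '' D, ⟨?_, hDc.image _ hsymm.continuousOn, ?_, ?_⟩, ?_⟩
  · exact E.symm.isOpen_image_of_subset_source hDo (by simp [hEt])
  · rw [disjoint_left]
    rintro _ ⟨z, hz, rfl⟩ ⟨u, hu⟩
    refine hDd.le_bot ⟨hz, u, ?_⟩
    simp only [hu]
    exact E.right_inv (by simp [hEt])
  · rw [← himg]
    exact closure_minimal (image_mono subset_union_left) (hcomp.image hsymm).isClosed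
  · rintro ⟨z, hz, hzq⟩
    have : E.symm z ∈ E.source := E.map_target (by simp [hEt])
    rw [hEs] at this
    exact this hzq

/-- The closure of a complementary domain does not retract onto the curve. -/
theorem IsComplementaryDomain.not_retract {C D : Set ↥Sphere2} (hD : IsComplementaryDomain C D)
    (hC : IsClosed C) {q : ↥Sphere2} (hqC : q ∉ C) (hqD : q ∉ D) (R : ↥Sphere2 → ↥Sphere2)
    (hR : ContinuousOn R (D ∪ C)) (hmaps : MapsTo R (D ∪ C) C) (hid : ∀ x ∈ C, R x = x) :
    False := by
  obtain ⟨E, hEs, hEt⟩ := exists_sphere_chart q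
  have hsymm : Continuous E.symm := by
    rw [← continuousOn_univ, ← hEt]
    exact E.continuousOn_symm
  have hDs : D ⊆ E.source := fun x hx => by
    rw [hEs]
    exact fun h => hqD ((show x = q from h) ▸ hx)
  have hCs : C ⊆ E.source := fun x hx => by
    rw [hEs]
    exact fun h => hqC ((show x = q from h) ▸ hx)
  have : CompactSpace ↥Sphere2 := isCompact_iff_compactSpace.1 (isCompact_sphere _ _)
  have hcl : IsClosed (D ∪ C) := by
    refine isClosed_of_closure_subset ?_
    rw [closure_union, hC.closure_eq]
    exact union_subset hD.closure_subset subset_union_right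
  have hcomp : IsCompact (E '' (D ∪ C)) :=
    hcl.isCompact.image_of_continuousOn (E.continuousOn.mono (union_subset hDs hCs))
  have hback : MapsTo E.symm (E '' D ∪ E '' C) (D ∪ C) := by
    rw [← image_union]
    rintro _ ⟨x, hx, rfl⟩
    rwa [E.left_inv (union_subset hDs hCs hx)]
  refine not_retract_onto_boundary (D := E '' D) (C := E '' C)
    (E.isOpen_image_of_subset_source hD.isOpen hDs) (hD.isConnected.nonempty.image _)
    (hcomp.isBounded.subset (image_mono subset_union_left)) ?_ ?_
    (fun z => E (R (E.symm z))) ?_ ?_ ?_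
  · rw [disjoint_left]
    rintro _ ⟨x, hx, rfl⟩ ⟨y, hy, hxy⟩
    rw [E.injOn (hCs hy) (hDs hx) hxy] at hy
    exact hD.disjoint.le_bot ⟨hx, hy⟩
  · rw [← image_union]
    exact closure_minimal (image_mono subset_union_left) hcomp.isClosed
  · refine E.continuousOn.comp (hR.comp hsymm.continuousOn hback) fun z hz => ?_
    exact hCs (hmaps (hback hz))
  · exact fun z hz => mem_image_of_mem _ (hmaps (hback hz))
  · rintro _ ⟨x, hx, rfl⟩
    simp only [E.left_inv (hCs hx), hid x hx]

/-- The quasisymmetry inequality of `f` with control function `η`. -/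
def QSBound (η : ℝ → ℝ) (f : ↥(sphere (0 : ℂ) 1) → ↥Sphere2) : Prop :=
  ∀ u v w : ↥(sphere (0 : ℂ) 1), u ≠ w →
    dist (f u) (f v) ≤ η (dist u v / dist u w) * dist (f u) (f w)

theorem IsQSControl.nonneg {η : ℝ → ℝ} (hη : IsQSControl η) {t : ℝ} (ht : 0 ≤ t) : 0 ≤ η t :=
  hη.2.2.1 ▸ hη.2.1.monotoneOn self_mem_Ici ht ht

theorem dist_unit_circle_le_two (u v : ↥(sphere (0 : ℂ) 1)) : dist u v ≤ 2 := by
  have hu : ‖(u : ℂ)‖ = 1 := mem_sphere_zero_iff_norm.1 u.2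
  have hv : ‖(v : ℂ)‖ = 1 := mem_sphere_zero_iff_norm.1 v.2
  rw [Subtype.dist_eq, dist_eq_norm]
  linarith [norm_sub_le (u : ℂ) v]

theorem QSBound.continuous {η : ℝ → ℝ} (hη : IsQSControl η)
    {f : ↥(sphere (0 : ℂ) 1) → ↥Sphere2} (hf : QSBound η f) : Continuous f := by
  rw [continuous_iff_continuousAt]
  intro u
  have hw : u ≠ -u := by
    intro h
    have h2 : (u : ℂ) = -u := congrArg Subtype.val h
    have h3 : (u : ℂ) = 0 := by linear_combination h2 / 2
    have := mem_sphere_zero_iff_norm.1 u.2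
    simp [h3] at this
  have hlim : Tendsto (fun v => η (dist u v / dist u (-u)) * dist (f u) (f (-u))) (𝓝 u) (𝓝 0) := by
    have h1 : Tendsto (fun v => dist u v / dist u (-u)) (𝓝 u) (𝓝[≥] 0) := by
      refine tendsto_nhdsWithin_iff.2 ⟨?_, Eventually.of_forall fun v => by simp; positivity⟩
      have : ContinuousAt (fun v => dist u v / dist u (-u)) u := by fun_prop
      simpa [ContinuousAt] using this
    have h2 : Tendsto η (𝓝[≥] 0) (𝓝 0) := by
      have h := hη.1 0 self_mem_Ici
      rw [ContinuousWithinAt, hη.2.2.1] at h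
      exact h
    simpa using (h2.comp h1).mul_const (dist (f u) (f (-u)))
  rw [ContinuousAt, tendsto_iff_dist_tendsto_zero]
  refine squeeze_zero (fun _ => dist_nonneg) (fun v => ?_) hlim
  rw [dist_comm]
  exact hf u v (-u) hw

theorem QSBound.dist_le {η : ℝ → ℝ} (hη : IsQSControl η)
    {f : ↥(sphere (0 : ℂ) 1) → ↥Sphere2} (hf : QSBound η f) {u v w : ↥(sphere (0 : ℂ) 1)}
    (h : dist u w ≤ dist u v) : dist (f u) (f w) ≤ η 1 * dist (f u) (f v) := by
  rcases eq_or_ne u v with rfl | huv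
  · rw [dist_self] at h
    rw [dist_le_zero.1 h]
    simp
  · refine (hf u w v huv).trans (mul_le_mul_of_nonneg_right ?_ dist_nonneg)
    exact hη.2.1.monotoneOn (mem_Ici.2 (by positivity)) (mem_Ici.2 zero_le_one)
      (div_le_one_of_le₀ h dist_nonneg)

theorem QSBound.diam_le {η : ℝ → ℝ} (hη : IsQSControl η)
    {f : ↥(sphere (0 : ℂ) 1) → ↥Sphere2} (hf : QSBound η f) {u v : ↥(sphere (0 : ℂ) 1)}
    (h : 1 ≤ dist u v) : diam (range f) ≤ 2 * η 2 * dist (f u) (f v) := by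
  have huv : u ≠ v := fun e => by
    rw [e, dist_self] at h
    linarith
  have key : ∀ w, dist (f u) (f w) ≤ η 2 * dist (f u) (f v) := by
    intro w
    refine (hf u w v huv).trans (mul_le_mul_of_nonneg_right ?_ dist_nonneg)
    refine hη.2.1.monotoneOn (mem_Ici.2 (by positivity)) (mem_Ici.2 zero_le_two) ?_
    rw [div_le_iff₀ (by linarith)]
    linarith [dist_unit_circle_le_two u w]
  refine diam_le_of_forall_dist_le ?_ ?_
  · have := hη.nonneg zero_le_two
    positivity
  · rintro _ ⟨w, rfl⟩ _ ⟨w', rfl⟩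
    linarith [dist_triangle_left (f w) (f w') (f u), key w, key w']

theorem convex_re_mul_conj_gt (v : ℂ) (s : ℝ) : Convex ℝ {z : ℂ | s < (z * conj v).re} :=
  convex_halfSpace_gt (f := fun z : ℂ => (z * conj v).re)
    ⟨fun x y => by simp [add_mul], fun c x => by simp [mul_assoc]⟩ s

theorem convex_im_mul_conj_gt (v : ℂ) (s : ℝ) : Convex ℝ {z : ℂ | s < (z * conj v).im} :=
  convex_halfSpace_gt (f := fun z : ℂ => (z * conj v).im)
    ⟨fun x y => by simp [add_mul], fun c x => by simp [mul_assoc]⟩ s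

theorem convex_im_mul_conj_lt (v : ℂ) (s : ℝ) : Convex ℝ {z : ℂ | (z * conj v).im < s} :=
  convex_halfSpace_lt (f := fun z : ℂ => (z * conj v).im)
    ⟨fun x y => by simp [add_mul], fun c x => by simp [mul_assoc]⟩ s

theorem convex_re_mul_conj_lt (v : ℂ) (s : ℝ) : Convex ℝ {z : ℂ | (z * conj v).re < s} :=
  convex_halfSpace_lt (f := fun z : ℂ => (z * conj v).re)
    ⟨fun x y => by simp [add_mul], fun c x => by simp [mul_assoc]⟩ s

theorem dist_sq_unit_circle (u v : ↥(sphere (0 : ℂ) 1)) :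
    dist u v ^ 2 = 2 - 2 * ((u : ℂ) * conj (v : ℂ)).re := by
  have hu : ‖(u : ℂ)‖ = 1 := mem_sphere_zero_iff_norm.1 u.2
  have hv : ‖(v : ℂ)‖ = 1 := mem_sphere_zero_iff_norm.1 v.2
  have h1 := Complex.sq_norm (u : ℂ)
  have h2 := Complex.sq_norm (v : ℂ)
  rw [hu, Complex.normSq_apply] at h1
  rw [hv, Complex.normSq_apply] at h2
  rw [Subtype.dist_eq, dist_eq_norm, Complex.sq_norm, Complex.normSq_apply]
  simp only [Complex.sub_re, Complex.sub_im, Complex.mul_re, Complex.conj_re, Complex.conj_im]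
  linarith

theorem zero_notMem_convexHull_of_dist_lt_one {W : Set ↥(sphere (0 : ℂ) 1)}
    (h : ∀ u ∈ W, ∀ v ∈ W, dist u v < 1) :
    (0 : ℂ) ∉ convexHull ℝ (Subtype.val '' W) := by
  rcases W.eq_empty_or_nonempty with rfl | ⟨v, hv⟩
  · simp
  intro h0
  have : convexHull ℝ (Subtype.val '' W) ⊆ {z : ℂ | 1 / 2 < (z * conj (v : ℂ)).re} := by
    refine convexHull_min ?_ (convex_re_mul_conj_gt _ _)
    rintro _ ⟨u, hu, rfl⟩
    have h1 := dist_sq_unit_circle u v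
    have h2 : dist u v ^ 2 < 1 := by
      rw [sq_lt_one_iff_abs_lt_one, abs_of_nonneg dist_nonneg]
      exact h u hu v hv
    show 1 / 2 < ((u : ℂ) * conj (v : ℂ)).re
    linarith
  have := this h0
  norm_num [mem_ofPred_eq] at this

/-- If the convex hull of a set of points of the circle meets the ray through `u₀`, then `u₀` is
no farther from some point of the set than another point of the set. -/
theorem exists_dist_le_of_ray_mem_convexHull {W : Set ↥(sphere (0 : ℂ) 1)}
    {u₀ : ↥(sphere (0 : ℂ) 1)} {t : ℝ} (ht : 0 ≤ t)
    (h : (t : ℂ) * u₀ ∈ convexHull ℝ (Subtype.val '' W)) :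
    ∃ u ∈ W, ∃ v ∈ W, dist u u₀ ≤ dist u v := by
  have hn : ‖(u₀ : ℂ)‖ = 1 := mem_sphere_zero_iff_norm.1 u₀.2
  have h0 : (u₀ : ℂ) * conj (u₀ : ℂ) = 1 := by
    rw [Complex.mul_conj, Complex.normSq_eq_norm_sq, hn]
    simp
  have htu : (t : ℂ) * u₀ * conj (u₀ : ℂ) = t := by rw [mul_assoc, h0, mul_one]
  obtain ⟨u, hu, hure⟩ : ∃ u ∈ W, 0 ≤ ((u : ℂ) * conj (u₀ : ℂ)).re := by
    by_contra! hcon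
    have : convexHull ℝ (Subtype.val '' W) ⊆ {z : ℂ | (z * conj (u₀ : ℂ)).re < 0} :=
      convexHull_min (by rintro _ ⟨u, hu, rfl⟩; exact hcon u hu) (convex_re_mul_conj_lt _ _)
    have h1 : ((t : ℂ) * u₀ * conj (u₀ : ℂ)).re < 0 := this h
    rw [htu, Complex.ofReal_re] at h1
    linarith
  obtain ⟨v, hv, hvim⟩ : ∃ v ∈ W, 0 ≤ ((v : ℂ) * conj (u₀ : ℂ)).im := by
    by_contra! hcon
    have : convexHull ℝ (Subtype.val '' W) ⊆ {z : ℂ | (z * conj (u₀ : ℂ)).im < 0} :=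
      convexHull_min (by rintro _ ⟨u, hu, rfl⟩; exact hcon u hu) (convex_im_mul_conj_lt _ _)
    have h1 : ((t : ℂ) * u₀ * conj (u₀ : ℂ)).im < 0 := this h
    simp [htu] at h1
  obtain ⟨w, hw, hwim⟩ : ∃ w ∈ W, ((w : ℂ) * conj (u₀ : ℂ)).im ≤ 0 := by
    by_contra! hcon
    have : convexHull ℝ (Subtype.val '' W) ⊆ {z : ℂ | 0 < (z * conj (u₀ : ℂ)).im} :=
      convexHull_min (by rintro _ ⟨u, hu, rfl⟩; exact hcon u hu) (convex_im_mul_conj_gt _ _)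
    have h1 : 0 < ((t : ℂ) * u₀ * conj (u₀ : ℂ)).im := this h
    simp [htu] at h1
  have key : ∀ x : ↥(sphere (0 : ℂ) 1),
      ((u : ℂ) * conj (u₀ : ℂ)).im * ((x : ℂ) * conj (u₀ : ℂ)).im ≤ 0 → dist u u₀ ≤ dist u x := by
    intro x hx
    have hxre : ((x : ℂ) * conj (u₀ : ℂ)).re ≤ 1 := by
      nlinarith [dist_sq_unit_circle x u₀, sq_nonneg (dist x u₀)]
    have hprod : (u : ℂ) * conj (x : ℂ) =
        ((u : ℂ) * conj (u₀ : ℂ)) * conj ((x : ℂ) * conj (u₀ : ℂ)) := by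
      simp only [map_mul, Complex.conj_conj]
      linear_combination (-(u : ℂ) * conj (x : ℂ)) * h0
    have hre : ((u : ℂ) * conj (x : ℂ)).re = ((u : ℂ) * conj (u₀ : ℂ)).re *
        ((x : ℂ) * conj (u₀ : ℂ)).re + ((u : ℂ) * conj (u₀ : ℂ)).im *
        ((x : ℂ) * conj (u₀ : ℂ)).im := by
      rw [hprod, Complex.mul_re, Complex.conj_re, Complex.conj_im]
      ring
    refine le_of_sq_le_sq ?_ dist_nonneg
    rw [dist_sq_unit_circle, dist_sq_unit_circle, hre]
    nlinarith [mul_le_mul_of_nonneg_left hxre hure]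
  rcases le_total 0 ((u : ℂ) * conj (u₀ : ℂ)).im with him | him
  · exact ⟨u, hu, w, hw, key w (mul_nonpos_of_nonneg_of_nonpos him hwim)⟩
  · exact ⟨u, hu, v, hv, key v (mul_nonpos_of_nonpos_of_nonneg him hvim)⟩

/-- The inverse of a parametrization `f` of a Jordan curve extends continuously to the sphere
in such a way that the value at `z` is a convex combination of parameters of nearly closest
points. -/
theorem exists_continuous_extension_inverse {f : ↥(sphere (0 : ℂ) 1) → ↥Sphere2}
    (hf : Continuous f) (hinj : Function.Injective f) :
    ∃ G : ↥Sphere2 → ℂ, Continuous G ∧ (∀ u, G (f u) = u) ∧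
      ∀ z, G z ∈ convexHull ℝ (Subtype.val '' {u | dist (f u) z ≤ 2 * infDist z (range f)}) := by
  classical
  set C := range f with hC
  have hCcl : IsClosed C := (isCompact_range hf).isClosed
  have hCne : C.Nonempty := ⟨f ⟨1, by simp⟩, mem_range_self _⟩
  obtain ⟨g, hg⟩ := exists_continuous_forall_mem_convex_of_local_const (X := ↥(Cᶜ)) (E := ℂ)
    (t := fun x => convexHull ℝ (Subtype.val ''
      {u : ↥(sphere (0 : ℂ) 1) | dist (f u) x < 2 * infDist (x : ↥Sphere2) C}))
    (fun x => convex_convexHull ℝ _) (by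
      intro x
      have hpos : 0 < infDist (x : ↥Sphere2) C := (hCcl.notMem_iff_infDist_pos hCne).1 x.2
      obtain ⟨y, ⟨u, rfl⟩, hu⟩ := (infDist_lt_iff hCne).1
        (show infDist (x : ↥Sphere2) C < 2 * infDist (x : ↥Sphere2) C by linarith)
      refine ⟨u, ?_⟩
      have hcont : Continuous fun y : ↥(Cᶜ) =>
          2 * infDist (y : ↥Sphere2) C - dist (f u) y := by
        have := (continuous_infDist_pt C).comp (continuous_subtype_val (p := (· ∈ Cᶜ)))
        fun_prop
      filter_upwards [hcont.continuousAt.eventually (lt_mem_nhds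
        (show 0 < 2 * infDist (x : ↥Sphere2) C - dist (f u) x by
          rw [dist_comm]; linarith))] with y hy
      exact subset_convexHull ℝ _ ⟨u,
        show dist (f u) (y : ↥Sphere2) < 2 * infDist (y : ↥Sphere2) C by linarith, rfl⟩)
  have hGex : ∀ z, ∃ w : ℂ, (∀ u, f u = z → w = u) ∧ (∀ h : z ∈ Cᶜ, w = g ⟨z, h⟩) := by
    intro z
    by_cases hz : z ∈ C
    · obtain ⟨u, rfl⟩ := hz
      exact ⟨u, fun v hv => by rw [hinj hv], fun h => absurd (mem_range_self u) h⟩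
    · exact ⟨g ⟨z, hz⟩, fun u hu => absurd ⟨u, hu⟩ hz, fun h => rfl⟩
  choose G hG1 hG2 using hGex
  have hmem : ∀ z, G z ∈
      convexHull ℝ (Subtype.val '' {u | dist (f u) z ≤ 2 * infDist z C}) := by
    intro z
    by_cases hz : z ∈ C
    · obtain ⟨u, rfl⟩ := hz
      rw [hG1 _ u rfl]
      refine subset_convexHull ℝ _ ⟨u, ?_, rfl⟩
      show dist (f u) (f u) ≤ _
      rw [dist_self]
      exact mul_nonneg zero_le_two infDist_nonneg
    · rw [hG2 z hz]
      have hsub : {u | dist (f u) z < 2 * infDist z C} ⊆ {u | dist (f u) z ≤ 2 * infDist z C} :=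
        fun u (hu : dist (f u) z < 2 * infDist z C) => hu.le
      exact convexHull_mono (image_mono hsub) (hg ⟨z, hz⟩)
  refine ⟨G, ?_, fun u => hG1 _ u rfl, hmem⟩
  rw [continuous_iff_continuousAt]
  intro z
  by_cases hz : z ∈ C
  · obtain ⟨v, rfl⟩ := hz
    rw [Metric.continuousAt_iff]
    intro ε hε
    have hemb : IsEmbedding f := (hf.isClosedEmbedding hinj).isEmbedding
    have hnh : ball v ε ∈ comap f (𝓝 (f v)) := hemb.nhds_eq_comap v ▸ ball_mem_nhds v hε
    obtain ⟨s, hs, hsub⟩ := hnh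
    obtain ⟨δ, hδ, hδs⟩ := Metric.mem_nhds_iff.1 hs
    refine ⟨δ / 4, by positivity, fun {z} hzv => ?_⟩
    rw [hG1 (f v) v rfl]
    have hinf : infDist z C ≤ dist z (f v) := infDist_le_dist_of_mem (mem_range_self v)
    have : convexHull ℝ (Subtype.val '' {u | dist (f u) z ≤ 2 * infDist z C}) ⊆
        ball (v : ℂ) ε := by
      refine convexHull_min ?_ (convex_ball _ _)
      rintro _ ⟨u, hu, rfl⟩
      have hu' : dist (f u) z ≤ 2 * infDist z C := hu
      have : u ∈ ball v ε := hsub (hδs (by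
        rw [mem_ball]
        linarith [dist_triangle (f u) z (f v)]))
      exact this
    exact this (hmem z)
  · have hcomp : ContinuousOn G Cᶜ := by
      rw [continuousOn_iff_continuous_domRestrict]
      exact g.continuous.congr fun x => (hG2 x x.2).symm
    exact hcomp.continuousAt (hCcl.isOpen_compl.mem_nhds hz)

/-- The corkscrew condition: near any point of an `η`-quasicircle and at any scale up to its
diameter, a complementary domain contains points quantitatively far from the curve. -/
theorem exists_corkscrew {η : ℝ → ℝ} (hη : IsQSControl η) :
    ∃ ε : ℝ, 0 < ε ∧ ε ≤ 1 / 16 ∧ ∀ f : ↥(sphere (0 : ℂ) 1) → ↥Sphere2, QSBound η f →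
      Function.Injective f → ∀ D : Set ↥Sphere2, IsComplementaryDomain (range f) D →
      ∀ q : ↥Sphere2, q ∉ range f → q ∉ D → ∀ p ∈ range f, ∀ r : ℝ, 0 < r →
      r ≤ diam (range f) → ∃ x ∈ D, dist x p ≤ r ∧ ε * r ≤ infDist x (range f) := by
  have hη1 := hη.nonneg zero_le_one
  have hη2 := hη.nonneg zero_le_two
  set ε : ℝ := 1 / (16 * (η 1 + η 2 + 1)) with hε
  have hεpos : 0 < ε := by positivity
  have hεeq : ε * (16 * (η 1 + η 2 + 1)) = 1 := by
    rw [hε]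
    field_simp
  have hε1 : 16 * ε + 16 * (ε * η 1) + 16 * (ε * η 2) = 1 := by linear_combination hεeq
  have hεη1 : 0 ≤ ε * η 1 := by positivity
  have hεη2 : 0 ≤ ε * η 2 := by positivity
  refine ⟨ε, hεpos, by linarith, ?_⟩
  intro f hf hinj D hD q hqC hqD p hp r hr hrd
  by_contra! hcon
  obtain ⟨u₀, rfl⟩ := hp
  have hfc : Continuous f := hf.continuous hη
  have hCcl : IsClosed (range f) := (isCompact_range hfc).isClosed
  have hDCcl : IsClosed (D ∪ range f) := by
    refine isClosed_of_closure_subset ?_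
    rw [closure_union, hCcl.closure_eq]
    exact union_subset hD.closure_subset subset_union_right
  obtain ⟨G, hGc, hGf, hGm⟩ := exists_continuous_extension_inverse hfc hinj
  have hinf : ∀ z ∈ D ∪ range f, dist z (f u₀) ≤ r → infDist z (range f) < ε * r := by
    rintro z (hz | hz) hzr
    · exact hcon z hz hzr
    · rw [infDist_zero_of_mem hz]
      positivity
  have hG0 : ∀ z ∈ D ∪ range f, dist z (f u₀) ≤ r → G z ≠ 0 := by
    intro z hz hzr h0
    have hm := hGm z
    rw [h0] at hm
    refine zero_notMem_convexHull_of_dist_lt_one ?_ hm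
    intro u (hu : dist (f u) z ≤ 2 * infDist z (range f)) v
      (hv : dist (f v) z ≤ 2 * infDist z (range f))
    by_contra! h1
    have h2 := hf.diam_le hη h1
    have h3 := hinf z hz hzr
    have h4 : dist (f u) (f v) ≤ 4 * (ε * r) := by
      linarith [dist_triangle_right (f u) (f v) z]
    have h5 : 2 * η 2 * dist (f u) (f v) ≤ 2 * η 2 * (4 * (ε * r)) := by gcongr
    nlinarith
  have hu₀ : ‖(u₀ : ℂ)‖ = 1 := mem_sphere_zero_iff_norm.1 u₀.2
  have hu₀0 : (u₀ : ℂ) ≠ 0 := by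
    rw [← norm_pos_iff, hu₀]
    exact one_pos
  set A : Set ↥Sphere2 :=
    {z | z ∈ D ∪ range f ∧ r ≤ dist z (f u₀) ∧ (z ∈ range f ∨ dist z (f u₀) = r)} with hA
  have hAcl : IsClosed A := by
    refine hDCcl.inter (IsClosed.inter ?_ (IsClosed.union hCcl ?_))
    · exact isClosed_le continuous_const (continuous_id.dist continuous_const)
    · exact isClosed_eq (continuous_id.dist continuous_const) continuous_const
  have hslit : ∀ z ∈ A, -G z / u₀ ∈ Complex.slitPlane := by
    rintro z ⟨hz, hzr, hor⟩
    by_contra hns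
    have hzinf : infDist z (range f) < ε * r := by
      rcases hor with h | h
      · rw [infDist_zero_of_mem h]
        positivity
      · exact hinf z hz h.le
    rw [Complex.mem_slitPlane_iff, not_or, not_lt, not_not] at hns
    have hGz : G z = ((-(-G z / u₀).re : ℝ) : ℂ) * u₀ := by
      have h1 : ((-(-G z / u₀).re : ℝ) : ℂ) = G z / u₀ := by
        apply Complex.ext
        · simp [neg_div]
        · have := hns.2
          rw [neg_div, Complex.neg_im, neg_eq_zero] at this
          simp [this]
      rw [h1]
      field_simp
    have hm := hGm z
    rw [hGz] at hm
    obtain ⟨u, hu, v, hv, huv⟩ := exists_dist_le_of_ray_mem_convexHull (by linarith [hns.1]) hm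
    replace hu : dist (f u) z ≤ 2 * infDist z (range f) := hu
    replace hv : dist (f v) z ≤ 2 * infDist z (range f) := hv
    have h1 := hf.dist_le hη huv
    have h4 : dist (f u) (f v) ≤ 4 * (ε * r) := by
      linarith [dist_triangle_right (f u) (f v) z]
    have h5 : η 1 * dist (f u) (f v) ≤ η 1 * (4 * (ε * r)) := by gcongr
    have h6 := dist_triangle_left z (f u₀) (f u)
    nlinarith
  have hθ : ContinuousOn (fun z => (-G z / u₀).arg) A := fun z hz =>
    ((Complex.continuousAt_arg (hslit z hz)).comp (f := fun z => -G z / u₀)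
      (by fun_prop : Continuous fun z => -G z / (u₀ : ℂ)).continuousAt).continuousWithinAt
  obtain ⟨θ, hθA⟩ := ContinuousMap.exists_restrict_eq hAcl
    (⟨_, continuousOn_iff_continuous_domRestrict.1 hθ⟩ : C(↥A, ℝ))
  have hθeq : ∀ z ∈ A, θ z = (-G z / u₀).arg := fun z hz =>
    congrArg (fun g : C(↥A, ℝ) => g ⟨z, hz⟩) hθA
  have hexp : ∀ z ∈ A, -(u₀ : ℂ) * Complex.exp (θ z * Complex.I) = G z / ‖G z‖ := by
    intro z hz
    have hne : G z ≠ 0 := by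
      intro h
      have := hslit z hz
      simp [h] at this
    have h1 := Complex.norm_mul_exp_arg_mul_I (-G z / u₀)
    rw [← hθeq z hz, norm_div, norm_neg, hu₀, div_one] at h1
    have hn : (‖G z‖ : ℂ) ≠ 0 := by
      simpa using hne
    field_simp at h1 ⊢
    linear_combination -h1
  let H : ↥Sphere2 → ℂ := fun z =>
    if dist z (f u₀) ≤ r then G z / ‖G z‖ else -(u₀ : ℂ) * Complex.exp (θ z * Complex.I)
  have hHn : ∀ z ∈ D ∪ range f, ‖H z‖ = 1 := by
    intro z hz
    by_cases h : dist z (f u₀) ≤ r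
    · have := hG0 z hz h
      simp only [H, if_pos h]
      rw [norm_div, Complex.norm_real, norm_norm, div_self (norm_ne_zero_iff.2 this)]
    · simp only [H, if_neg h]
      rw [norm_mul, norm_neg, hu₀, Complex.norm_exp_ofReal_mul_I, one_mul]
  have hHge : ∀ z ∈ (D ∪ range f) ∩ {z | r ≤ dist z (f u₀)},
      H z = -(u₀ : ℂ) * Complex.exp (θ z * Complex.I) := by
    rintro z ⟨hz, hzr⟩
    by_cases h : dist z (f u₀) ≤ r
    · simp only [H, if_pos h]
      exact (hexp z ⟨hz, hzr, Or.inr (le_antisymm h hzr)⟩).symm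
    · simp only [H, if_neg h]
  have hHc : ContinuousOn H (D ∪ range f) := by
    have hsplit : D ∪ range f = ((D ∪ range f) ∩ {z | dist z (f u₀) ≤ r}) ∪
        ((D ∪ range f) ∩ {z | r ≤ dist z (f u₀)}) := by
      rw [← inter_union_distrib_left]
      refine (inter_eq_left.2 fun z _ => ?_).symm
      exact le_total (dist z (f u₀)) r
    rw [hsplit]
    refine ContinuousOn.union_of_isClosed ?_ ?_
      (hDCcl.inter (isClosed_le (continuous_id.dist continuous_const) continuous_const))
      (hDCcl.inter (isClosed_le continuous_const (continuous_id.dist continuous_const)))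
    · have : ContinuousOn (fun z => G z / (‖G z‖ : ℂ))
          ((D ∪ range f) ∩ {z | dist z (f u₀) ≤ r}) := by
        refine ContinuousOn.div hGc.continuousOn (by fun_prop) ?_
        rintro z ⟨hz, hzr⟩
        simpa using hG0 z hz hzr
      refine this.congr ?_
      rintro z ⟨hz, hzr⟩
      exact if_pos hzr
    · refine ContinuousOn.congr (Continuous.continuousOn ?_) hHge
      fun_prop
  have hHf : ∀ u, H (f u) = u := by
    intro u
    have hun : ‖(u : ℂ)‖ = 1 := mem_sphere_zero_iff_norm.1 u.2
    have hu1 : G (f u) / ‖G (f u)‖ = u := by rw [hGf, hun]; simp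
    by_cases h : dist (f u) (f u₀) ≤ r
    · simp only [H, if_pos h, hu1]
    · simp only [H, if_neg h]
      rw [hexp (f u) ⟨Or.inr (mem_range_self u), (not_le.1 h).le, Or.inl (mem_range_self u)⟩, hu1]
  classical
  let N : ℂ → ↥(sphere (0 : ℂ) 1) := fun w =>
    if h : ‖w‖ = 1 then ⟨w, mem_sphere_zero_iff_norm.2 h⟩ else u₀
  have hN : ∀ z ∈ D ∪ range f, (N (H z) : ℂ) = H z := by
    intro z hz
    simp only [N, dif_pos (hHn z hz)]
  have hNc : ContinuousOn (fun z => N (H z)) (D ∪ range f) := by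
    rw [continuousOn_iff_continuous_domRestrict] at hHc ⊢
    refine continuous_induced_rng.2 (hHc.congr fun z => ?_)
    exact (hN z z.2).symm
  refine hD.not_retract hCcl hqC hqD (fun z => f (N (H z))) (hfc.comp_continuousOn hNc)
    (fun z _ => mem_range_self _) ?_
  rintro _ ⟨u, rfl⟩
  congr 1
  apply Subtype.ext
  rw [hN _ (Or.inr (mem_range_self u)), hHf]

theorem norm_coe_sphere2 (x : ↥Sphere2) : ‖(x : EuclideanSpace ℝ (Fin 3))‖ = 1 :=
  mem_sphere_zero_iff_norm.1 x.2

theorem dist_sphere2_le_two (x y : ↥Sphere2) : dist x y ≤ 2 := by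
  rw [Subtype.dist_eq, dist_eq_norm]
  linarith [norm_sub_le (x : EuclideanSpace ℝ (Fin 3)) y, norm_coe_sphere2 x, norm_coe_sphere2 y]

theorem dist_sq_sphere2 (x y : ↥Sphere2) :
    dist x y ^ 2 = 2 - 2 * inner ℝ (x : EuclideanSpace ℝ (Fin 3)) y := by
  rw [Subtype.dist_eq, dist_eq_norm, norm_sub_sq_real, norm_coe_sphere2, norm_coe_sphere2]
  ring

theorem diam_sphere2_le_two (C : Set ↥Sphere2) : diam C ≤ 2 :=
  diam_le_of_forall_dist_le zero_le_two fun x _ y _ => dist_sphere2_le_two x y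

theorem isPreconnected_ball_sphere2 (x : ↥Sphere2) {s : ℝ} (hs0 : 0 < s) (hs : s ≤ 1) :
    IsPreconnected (ball x s) := by
  rw [← IsInducing.subtypeVal.isPreconnected_image]
  set c : ℝ := 1 - s ^ 2 / 2 with hc
  have hc0 : 0 ≤ c := by nlinarith
  have hball : ∀ y : ↥Sphere2, y ∈ ball x s ↔ c < inner ℝ (x : EuclideanSpace ℝ (Fin 3)) y := by
    intro y
    rw [mem_ball, dist_comm, ← sq_lt_sq₀ dist_nonneg hs0.le, dist_sq_sphere2, hc]
    constructor <;> intro h <;> linarith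
  set P : Set (EuclideanSpace ℝ (Fin 3)) := {v | c * ‖v‖ < inner ℝ (x : EuclideanSpace ℝ (Fin 3)) v}
    with hP
  have hP0 : ∀ v ∈ P, 0 < ‖v‖ := by
    intro v hv
    replace hv : c * ‖v‖ < inner ℝ (x : EuclideanSpace ℝ (Fin 3)) v := hv
    rw [norm_pos_iff]
    rintro rfl
    simp at hv
  have hconv : Convex ℝ P := by
    intro v hv w hw a b ha hb hab
    replace hv : c * ‖v‖ < inner ℝ (x : EuclideanSpace ℝ (Fin 3)) v := hv
    replace hw : c * ‖w‖ < inner ℝ (x : EuclideanSpace ℝ (Fin 3)) w := hw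
    show c * ‖a • v + b • w‖ < inner ℝ (x : EuclideanSpace ℝ (Fin 3)) (a • v + b • w)
    rw [inner_add_right, inner_smul_right, inner_smul_right]
    have h1 : ‖a • v + b • w‖ ≤ a * ‖v‖ + b * ‖w‖ := by
      refine (norm_add_le _ _).trans_eq ?_
      rw [norm_smul, norm_smul, Real.norm_of_nonneg ha, Real.norm_of_nonneg hb]
    have h2 := mul_le_mul_of_nonneg_left h1 hc0
    rcases ha.eq_or_lt with rfl | ha
    · have : b = 1 := by linarith
      subst this
      linarith
    · nlinarith [mul_lt_mul_of_pos_left hv ha, mul_le_mul_of_nonneg_left hw.le hb]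
  have himg : Subtype.val '' ball x s = (fun v => ‖v‖⁻¹ • v) '' P := by
    ext v
    constructor
    · rintro ⟨y, hy, rfl⟩
      refine ⟨y, ?_, ?_⟩
      · show c * ‖(y : EuclideanSpace ℝ (Fin 3))‖ < _
        rw [norm_coe_sphere2, mul_one]
        exact (hball y).1 hy
      · simp [norm_coe_sphere2]
    · rintro ⟨v, hv, rfl⟩
      have h0 := hP0 v hv
      have hmem : ‖v‖⁻¹ • v ∈ Sphere2 := by
        rw [Sphere2, mem_sphere_zero_iff_norm, norm_smul, norm_inv, norm_norm,
          inv_mul_cancel₀ h0.ne']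
      refine ⟨⟨_, hmem⟩, (hball _).2 ?_, rfl⟩
      show c < inner ℝ (x : EuclideanSpace ℝ (Fin 3)) (‖v‖⁻¹ • v)
      rw [inner_smul_right, inv_mul_eq_div, lt_div_iff₀ h0]
      exact hv
  rw [himg]
  have hcont : ContinuousOn (fun v : EuclideanSpace ℝ (Fin 3) => ‖v‖⁻¹) P :=
    continuous_norm.continuousOn.inv₀ fun v hv => (hP0 v hv).ne'
  exact hconv.isPreconnected.image _ (by fun_prop)

/-- The complementary domains of the peripheral circles of a set: pairwise disjoint open sets,
containing, near every point of the circle and at every scale up to its diameter, a ball of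
comparable size. -/
theorem exists_complementary_domains {S : Set ↥Sphere2}
    (hq : UniformQuasicircles {C | IsPeripheralCircle S C}) :
    ∃ ε : ℝ, 0 < ε ∧ ε ≤ 1 / 16 ∧ ∃ D : {C // IsPeripheralCircle S C} → Set ↥Sphere2,
      Pairwise (fun C C' => Disjoint (D C) (D C')) ∧
      ∀ C : {C // IsPeripheralCircle S C}, C.1.Nonempty ∧ 0 < diam C.1 ∧
        ∀ p ∈ C.1, ∀ r, 0 < r → r ≤ diam C.1 → ∃ x, dist x p ≤ r ∧ ball x (ε * r) ⊆ D C := by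
  obtain ⟨η, hη, hq⟩ := hq
  obtain ⟨ε, hε, hε16, hcork⟩ := exists_corkscrew hη
  have main : ∀ C : {C // IsPeripheralCircle S C}, ∃ D : Set ↥Sphere2, Disjoint D S ∧
      IsComplementaryDomain C.1 D ∧ C.1.Nonempty ∧ 0 < diam C.1 ∧
      ∀ p ∈ C.1, ∀ r, 0 < r → r ≤ diam C.1 → ∃ x, dist x p ≤ r ∧ ball x (ε * r) ⊆ D := by
    rintro ⟨C, hC⟩
    obtain ⟨f, rfl, hinj, hf⟩ := hq C hC
    have hfq : QSBound η f := hf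
    obtain ⟨q, hqS, hqC⟩ := hC.2.2.nonempty
    obtain ⟨D, hD, hqD⟩ := exists_isComplementaryDomain f (hfq.continuous hη) hinj hqC
    have hne : (range f).Nonempty := ⟨f ⟨1, by simp⟩, mem_range_self _⟩
    have hDS : Disjoint D S := by
      rw [disjoint_left]
      intro y hyD hyS
      refine hqD (hD.subset_of_isPreconnected hC.2.2.isPreconnected disjoint_sdiff_left
        ⟨y, ⟨hyS, ?_⟩, hyD⟩ ⟨hqS, hqC⟩)
      exact disjoint_left.1 hD.disjoint hyD
    refine ⟨D, hDS, hD, hne, ?_, ?_⟩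
    · have hbd : Bornology.IsBounded (range f) := (isCompact_range (hfq.continuous hη)).isBounded
      refine (dist_pos.2 ?_).trans_le (dist_le_diam_of_mem hbd
        (mem_range_self (⟨1, by simp⟩ : ↥(sphere (0 : ℂ) 1)))
        (mem_range_self (⟨-1, by simp⟩ : ↥(sphere (0 : ℂ) 1))))
      intro h
      have h1 : (1 : ℂ) = -1 := congrArg Subtype.val (hinj h)
      norm_num at h1
    · intro p hp r hr hrd
      obtain ⟨x, hxD, hxp, hx⟩ := hcork f hfq hinj D hD q hqC hqD p hp r hr hrd
      refine ⟨x, hxp, hD.subset_of_isPreconnected (isPreconnected_ball_sphere2 x (by positivity) ?_)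
        ?_ ⟨x, mem_ball_self (by positivity), hxD⟩⟩
      · nlinarith [diam_sphere2_le_two (range f)]
      · exact disjoint_ball_infDist.mono_left (ball_subset_ball hx)
  choose D hDS hD hne hdiam hball using main
  refine ⟨ε, hε, hε16, D, ?_, fun C => ⟨hne C, hdiam C, hball C⟩⟩
  have hsub : ∀ C C', (D C ∩ D C').Nonempty → D C ⊆ D C' := fun C C' h =>
    (hD C').subset_of_isPreconnected (hD C).isConnected.isPreconnected
      ((hDS C).mono_right C'.2.1) h
  have hcl : ∀ C, C.1 ⊆ closure (D C) := by
    intro C p hp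
    rw [Metric.mem_closure_iff]
    intro s hs
    have hr : 0 < min (s / 2) (diam C.1) := lt_min (by positivity) (hdiam C)
    obtain ⟨x, hx, hxD⟩ := hball C p hp _ hr (min_le_right _ _)
    refine ⟨x, hxD (mem_ball_self (by positivity)), ?_⟩
    rw [dist_comm]
    linarith [min_le_left (s / 2) (diam C.1)]
  have hCC : ∀ C C', (D C ∩ D C').Nonempty → C.1 ⊆ C'.1 := by
    intro C C' h p hp
    have h1 := (hD C').closure_subset (closure_mono (hsub C C' h) (hcl C hp))
    refine h1.resolve_left fun h2 => disjoint_left.1 (hDS C') h2 (C.2.1 hp)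
  intro C C' hne'
  by_contra hnd
  rw [not_disjoint_iff_nonempty_inter] at hnd
  exact hne' (Subtype.ext ((hCC C C' hnd).antisymm (hCC C' C (by rwa [inter_comm]))))

theorem norm_normalize_sub_normalize_le {E : Type*} [NormedAddCommGroup E] [NormedSpace ℝ E]
    {v w : E} (hv : 1 ≤ ‖v‖) (hw : 1 ≤ ‖w‖) : ‖‖v‖⁻¹ • v - ‖w‖⁻¹ • w‖ ≤ 2 * ‖v - w‖ := by
  have hv0 : 0 < ‖v‖ := by linarith
  have hw0 : 0 < ‖w‖ := by linarith
  have h : ‖v‖⁻¹ • v - ‖w‖⁻¹ • w = ‖v‖⁻¹ • (v - w) + (‖v‖⁻¹ - ‖w‖⁻¹) • w := by module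
  have h1 : (‖v‖⁻¹ - ‖w‖⁻¹) = ‖v‖⁻¹ * ‖w‖⁻¹ * (‖w‖ - ‖v‖) := by field_simp
  have h2 : ‖(‖v‖⁻¹ - ‖w‖⁻¹) • w‖ = ‖v‖⁻¹ * |‖w‖ - ‖v‖| := by
    rw [norm_smul, h1, Real.norm_eq_abs, abs_mul, abs_of_pos (by positivity)]
    field_simp
  have h3 : |‖w‖ - ‖v‖| ≤ ‖v - w‖ := by
    rw [abs_sub_comm]
    exact abs_norm_sub_norm_le v w
  have h4 : ‖v‖⁻¹ ≤ 1 := inv_le_one_of_one_le₀ hv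
  rw [h]
  refine (norm_add_le _ _).trans ?_
  rw [h2, norm_smul, norm_inv, norm_norm]
  have : ‖v‖⁻¹ * ‖v - w‖ ≤ 1 * ‖v - w‖ := by gcongr
  have : ‖v‖⁻¹ * |‖w‖ - ‖v‖| ≤ 1 * ‖v - w‖ := by gcongr
  linarith

/-- Coordinates on the tangent plane of the sphere at `x`. -/
theorem exists_tangent_coordinates (x : ↥Sphere2) :
    ∃ (L : EuclideanSpace ℝ (Fin 2) →ₗᵢ[ℝ] EuclideanSpace ℝ (Fin 3))
      (π : EuclideanSpace ℝ (Fin 3) → EuclideanSpace ℝ (Fin 2)),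
      LipschitzWith 1 π ∧ (∀ w (t : ℝ), π (L w + t • (x : EuclideanSpace ℝ (Fin 3))) = w) ∧
      (∀ w, inner ℝ (x : EuclideanSpace ℝ (Fin 3)) (L w) = 0) ∧
      ∀ v, inner ℝ (x : EuclideanSpace ℝ (Fin 3)) v = 0 → L (π v) = v := by
  have hx0 : (x : EuclideanSpace ℝ (Fin 3)) ≠ 0 := by
    rw [← norm_pos_iff, norm_coe_sphere2]
    exact one_pos
  have : Fact (Module.finrank ℝ (EuclideanSpace ℝ (Fin 3)) = 2 + 1) := ⟨by simp⟩
  let e := (OrthonormalBasis.fromOrthogonalSpanSingleton (𝕜 := ℝ) 2 hx0).repr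
  let K := (ℝ ∙ (x : EuclideanSpace ℝ (Fin 3)))ᗮ
  have hpe : ∀ w : K, K.orthogonalProjectionOnto (w : EuclideanSpace ℝ (Fin 3)) = w := fun w =>
    Submodule.orthogonalProjectionOnto_mem_subspace_eq_self w
  refine ⟨K.subtypeₗᵢ.comp e.symm.toLinearIsometry, fun v => e (K.orthogonalProjectionOnto v),
    ?_, ?_, ?_, ?_⟩
  · refine LipschitzWith.of_dist_le_mul fun v w => ?_
    rw [e.dist_map, dist_eq_norm, dist_eq_norm, ← map_sub, NNReal.coe_one, one_mul]
    exact Submodule.norm_orthogonalProjectionOnto_apply_le K _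
  · intro w t
    have h1 : K.orthogonalProjectionOnto (t • (x : EuclideanSpace ℝ (Fin 3))) = 0 := by
      refine Submodule.orthogonalProjectionOnto_apply_of_mem_orthogonal ?_
      exact Submodule.le_orthogonal_orthogonal _
        (Submodule.smul_mem _ t (Submodule.mem_span_singleton_self _))
    show e (K.orthogonalProjectionOnto ((e.symm w : K) + t • (x : EuclideanSpace ℝ (Fin 3)))) = w
    rw [map_add, h1, add_zero, hpe]
    simp
  · intro w
    exact Submodule.mem_orthogonal_singleton_iff_inner_right.1 (e.symm w).2
  · intro v hv
    have hvK : v ∈ K := Submodule.mem_orthogonal_singleton_iff_inner_right.2 hv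
    show ((e.symm (e (K.orthogonalProjectionOnto v)) : K) : EuclideanSpace ℝ (Fin 3)) = v
    rw [LinearIsometryEquiv.symm_apply_apply]
    exact congrArg Subtype.val (hpe ⟨v, hvK⟩)

theorem isAddHaarMeasure_hausdorffMeasure_two :
    (μH[2] : Measure (EuclideanSpace ℝ (Fin 2))).IsAddHaarMeasure := by
  have := isAddHaarMeasure_hausdorffMeasure (E := EuclideanSpace ℝ (Fin 2))
  simpa using this

theorem hausdorffMeasure_ball_le_sphereMeasure_ball (x : ↥Sphere2) {r : ℝ} (hr : 0 < r)
    (hr2 : r ≤ 2) :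
    μH[2] (ball (0 : EuclideanSpace ℝ (Fin 2)) (r / 2)) ≤ sphereMeasure (ball x r) := by
  obtain ⟨L, π, hπ, hπL, hL, -⟩ := exists_tangent_coordinates x
  have hlip : LipschitzWith 1 (fun y : ↥Sphere2 => π y) := by
    have := hπ.comp (LipschitzWith.subtype_val Sphere2)
    rwa [one_mul] at this
  have h := hlip.hausdorffMeasure_image_le (d := 2) zero_le_two (ball x r)
  rw [ENNReal.coe_one, ENNReal.one_rpow, one_mul] at h
  refine (measure_mono ?_).trans h
  intro w hw
  rw [mem_ball_zero_iff] at hw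
  have hw1 : ‖w‖ ^ 2 ≤ 1 := by nlinarith [norm_nonneg w]
  set s := √(1 - ‖w‖ ^ 2) with hs
  have hs2 : s ^ 2 = 1 - ‖w‖ ^ 2 := Real.sq_sqrt (by linarith)
  have hs0 : 0 ≤ s := Real.sqrt_nonneg _
  have hLx : inner ℝ (L w) (x : EuclideanSpace ℝ (Fin 3)) = 0 := by
    rw [real_inner_comm]
    exact hL w
  have hmem : L w + s • (x : EuclideanSpace ℝ (Fin 3)) ∈ Sphere2 := by
    refine mem_sphere_zero_iff_norm.2 ?_
    rw [← sq_eq_sq₀ (norm_nonneg _) zero_le_one,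
      norm_add_sq_real, inner_smul_right, hLx, norm_smul, norm_coe_sphere2, L.norm_map,
      mul_one, Real.norm_of_nonneg hs0, hs2]
    ring
  refine ⟨⟨_, hmem⟩, ?_, hπL w s⟩
  rw [mem_ball, dist_comm, ← sq_lt_sq₀ dist_nonneg hr.le, dist_sq_sphere2]
  show 2 - 2 * inner ℝ (x : EuclideanSpace ℝ (Fin 3)) (L w + s • (x : EuclideanSpace ℝ (Fin 3)))
    < r ^ 2
  rw [inner_add_right, hL, inner_smul_right, real_inner_self_eq_norm_sq, norm_coe_sphere2]
  have hs1 : s ≤ 1 := by nlinarith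
  have hw2 : ‖w‖ ^ 2 < (r / 2) ^ 2 := by gcongr
  nlinarith

theorem sphereMeasure_ball_le_hausdorffMeasure_ball (x : ↥Sphere2) {r : ℝ} (hr : 0 < r)
    (hr1 : r ≤ 1) :
    sphereMeasure (ball x r) ≤
      (2 : ℝ≥0∞) ^ (2 : ℝ) * μH[2] (ball (0 : EuclideanSpace ℝ (Fin 2)) (2 * r)) := by
  obtain ⟨L, π, -, -, hL, hLπ⟩ := exists_tangent_coordinates x
  have hLx : ∀ w, inner ℝ (L w) (x : EuclideanSpace ℝ (Fin 3)) = 0 := by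
    intro w
    rw [real_inner_comm]
    exact hL w
  have hnorm : ∀ w, 1 ≤ ‖L w + (x : EuclideanSpace ℝ (Fin 3))‖ := by
    intro w
    rw [← sq_le_sq₀ zero_le_one (norm_nonneg _), norm_add_sq_real, hLx, norm_coe_sphere2]
    nlinarith [sq_nonneg ‖L w‖]
  let g : EuclideanSpace ℝ (Fin 2) → ↥Sphere2 := fun w =>
    ⟨‖L w + x‖⁻¹ • (L w + x), by
      refine mem_sphere_zero_iff_norm.2 ?_
      rw [norm_smul, norm_inv, norm_norm, inv_mul_cancel₀ (by linarith [hnorm w])]⟩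
  have hg : LipschitzWith 2 g := by
    refine LipschitzWith.of_dist_le_mul fun v w => ?_
    rw [Subtype.dist_eq, dist_eq_norm, dist_eq_norm]
    refine (norm_normalize_sub_normalize_le (hnorm v) (hnorm w)).trans_eq ?_
    rw [add_sub_add_right_eq_sub, ← map_sub, L.norm_map]
    norm_num
  have h := hg.hausdorffMeasure_image_le (d := 2) zero_le_two
    (ball (0 : EuclideanSpace ℝ (Fin 2)) (2 * r))
  refine (measure_mono ?_).trans h
  intro y hy
  set a : ℝ := inner ℝ (x : EuclideanSpace ℝ (Fin 3)) y with ha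
  have hd := dist_sq_sphere2 x y
  rw [mem_ball, dist_comm] at hy
  have hd2 : dist x y ^ 2 < r ^ 2 := by gcongr
  have ha2 : 1 / 2 < a := by nlinarith
  have ha0 : 0 < a := by linarith
  have ha1 : a ≤ 1 := by nlinarith [sq_nonneg (dist x y)]
  have horth : inner ℝ (x : EuclideanSpace ℝ (Fin 3)) (a⁻¹ • (y : EuclideanSpace ℝ (Fin 3)) - x)
      = 0 := by
    rw [inner_sub_right, inner_smul_right, ← ha, real_inner_self_eq_norm_sq, norm_coe_sphere2,
      inv_mul_cancel₀ ha0.ne']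
    norm_num
  have hLw := hLπ _ horth
  refine ⟨π (a⁻¹ • (y : EuclideanSpace ℝ (Fin 3)) - x), ?_, ?_⟩
  · rw [mem_ball_zero_iff, ← L.norm_map, hLw, ← sq_lt_sq₀ (norm_nonneg _) (by positivity),
      norm_sub_sq_real, norm_smul, norm_inv, Real.norm_of_nonneg ha0.le, norm_coe_sphere2,
      norm_coe_sphere2, real_inner_comm, inner_smul_right, ← ha, inv_mul_cancel₀ ha0.ne']
    have h1 : (a⁻¹ * 1) ^ 2 - 2 * 1 + 1 ^ 2 = (1 - a ^ 2) / a ^ 2 := by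
      field_simp
      ring
    rw [h1, div_lt_iff₀ (by positivity)]
    have h2 : 1 - a ^ 2 < r ^ 2 := by nlinarith
    have h3 : r ^ 2 * (1 / 4) ≤ r ^ 2 * a ^ 2 := by
      gcongr
      nlinarith
    nlinarith
  · apply Subtype.ext
    show ‖L (π (a⁻¹ • (y : EuclideanSpace ℝ (Fin 3)) - x)) + x‖⁻¹ •
      (L (π (a⁻¹ • (y : EuclideanSpace ℝ (Fin 3)) - x)) + (x : EuclideanSpace ℝ (Fin 3))) = y
    rw [hLw, sub_add_cancel, norm_smul, norm_inv, Real.norm_of_nonneg ha0.le, norm_coe_sphere2,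
      mul_one, inv_inv, smul_smul, mul_inv_cancel₀ ha0.ne', one_smul]

instance : CompactSpace ↥Sphere2 := isCompact_iff_compactSpace.1 (isCompact_sphere _ _)

/-- Ahlfors `2`-regularity of the sphere. -/
theorem exists_ahlfors_bounds : ∃ c C : ℝ≥0∞, c ≠ 0 ∧ C ≠ ∞ ∧
    (∀ (x : ↥Sphere2) (r : ℝ), 0 < r → r ≤ 2 →
      c * ENNReal.ofReal r ^ 2 ≤ sphereMeasure (ball x r)) ∧
    ∀ (x : ↥Sphere2) (r : ℝ), 0 < r → sphereMeasure (ball x r) ≤ C * ENNReal.ofReal r ^ 2 := by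
  have := isAddHaarMeasure_hausdorffMeasure_two
  set m : ℝ≥0∞ := μH[2] (ball (0 : EuclideanSpace ℝ (Fin 2)) 1) with hm
  have hm0 : m ≠ 0 := (measure_ball_pos _ _ one_pos).ne'
  have hmt : m ≠ ∞ := measure_ball_lt_top.ne
  have hball : ∀ s : ℝ, 0 ≤ s →
      μH[2] (ball (0 : EuclideanSpace ℝ (Fin 2)) s) = ENNReal.ofReal s ^ 2 * m := by
    intro s hs
    rw [Measure.addHaar_ball _ _ hs, finrank_euclideanSpace_fin, ENNReal.ofReal_pow hs]
  have hupper : ∀ (x : ↥Sphere2) (r : ℝ), 0 < r → r ≤ 1 →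
      sphereMeasure (ball x r) ≤ 16 * m * ENNReal.ofReal r ^ 2 := by
    intro x r hr hr1
    refine (sphereMeasure_ball_le_hausdorffMeasure_ball x hr hr1).trans_eq ?_
    rw [hball _ (by positivity), ENNReal.ofReal_mul zero_le_two, mul_pow]
    norm_num
    ring
  have hfin : sphereMeasure univ ≠ ∞ := by
    refine (isCompact_univ.measure_lt_top_of_nhdsWithin fun x _ => ?_).ne
    refine ⟨ball x 1, mem_nhdsWithin_of_mem_nhds (ball_mem_nhds x one_pos), ?_⟩
    refine (hupper x 1 one_pos le_rfl).trans_lt ?_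
    exact ENNReal.mul_lt_top (ENNReal.mul_lt_top (by simp) hmt.lt_top) (by simp)
  refine ⟨ENNReal.ofReal (1 / 2) ^ 2 * m, max (16 * m) (sphereMeasure univ), ?_, ?_, ?_, ?_⟩
  · simp [hm0]
  · exact (max_lt (ENNReal.mul_lt_top (by simp) hmt.lt_top) hfin.lt_top).ne
  · intro x r hr hr2
    refine le_trans (le_of_eq ?_) (hausdorffMeasure_ball_le_sphereMeasure_ball x hr hr2)
    rw [hball _ (by positivity), show r / 2 = 1 / 2 * r by ring,
      ENNReal.ofReal_mul (by norm_num), mul_pow]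
    ring
  · intro x r hr
    rcases le_total r 1 with h | h
    · exact (hupper x r hr h).trans (by gcongr; exact le_max_left _ _)
    · calc sphereMeasure (ball x r) ≤ sphereMeasure univ * 1 := by
            rw [mul_one]
            exact measure_mono (subset_univ _)
        _ ≤ _ := by
            gcongr
            · exact le_max_right _ _
            · exact one_le_pow₀ (ENNReal.one_le_ofReal.2 h)

theorem isBounded_sphere2 (C : Set ↥Sphere2) : Bornology.IsBounded C :=
  isCompact_univ.isBounded.subset (subset_univ C)

instance : IsFiniteMeasure sphereMeasure := by
  obtain ⟨_, C, _, hC, _, hup⟩ := exists_ahlfors_bounds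
  let x : ↥Sphere2 := ⟨EuclideanSpace.single 0 1, mem_sphere_zero_iff_norm.2 (by simp)⟩
  refine ⟨(measure_mono fun y _ => ?_).trans_lt ((hup x 3 (by norm_num)).trans_lt
    (ENNReal.mul_lt_top hC.lt_top (by simp)))⟩
  rw [mem_ball]
  linarith [dist_sphere2_le_two y x]

/-- The peripheral circles are quantitatively separated: each one is comparable to a ball, and
the balls are pairwise disjoint. -/
theorem exists_disjoint_balls {S : Set ↥Sphere2}
    (hq : UniformQuasicircles {C | IsPeripheralCircle S C}) :
    ∃ ε : ℝ, 0 < ε ∧ ε ≤ 1 ∧ ∃ x : {C // IsPeripheralCircle S C} → ↥Sphere2,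
      Pairwise (fun C C' => Disjoint (ball (x C) (ε * diam C.1)) (ball (x C') (ε * diam C'.1))) ∧
      ∀ C : {C // IsPeripheralCircle S C}, 0 < diam C.1 ∧
        C.1 ⊆ closedBall (x C) (2 * diam C.1) := by
  obtain ⟨ε, hε, hε16, D, hdisj, hD⟩ := exists_complementary_domains hq
  have hx : ∀ C : {C // IsPeripheralCircle S C}, ∃ x, C.1 ⊆ closedBall x (2 * diam C.1) ∧
      ball x (ε * diam C.1) ⊆ D C := by
    intro C
    obtain ⟨⟨p, hp⟩, hd, hC⟩ := hD C
    obtain ⟨x, hxp, hx⟩ := hC p hp _ hd le_rfl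
    refine ⟨x, fun y hy => ?_, hx⟩
    rw [mem_closedBall]
    linarith [dist_triangle_right y x p, dist_le_diam_of_mem (isBounded_sphere2 C.1) hy hp]
  choose x hx1 hx2 using hx
  exact ⟨ε, hε, by linarith, x, fun C C' h => (hdisj h).mono (hx2 C) (hx2 C'),
    fun C => ⟨(hD C).2.1, hx1 C⟩⟩

theorem finite_setOf_le_diam {S : Set ↥Sphere2}
    (hq : UniformQuasicircles {C | IsPeripheralCircle S C}) {δ : ℝ} (hδ : 0 < δ) :
    {C : {C // IsPeripheralCircle S C} | δ ≤ diam C.1}.Finite := by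
  obtain ⟨ε, hε, hε1, x, hdisj, -⟩ := exists_disjoint_balls hq
  obtain ⟨c, _, hc, -, hlow, -⟩ := exists_ahlfors_bounds
  refine (Measure.finite_const_le_meas_of_disjoint_iUnion sphereMeasure
    (ε := c * ENNReal.ofReal (ε * δ) ^ 2)
    (ENNReal.mul_pos hc (pow_ne_zero _ (ENNReal.ofReal_pos.2 (by positivity)).ne'))
    (fun C => measurableSet_ball) hdisj (measure_ne_top _ _)).subset fun C (hC : δ ≤ _) => ?_
  refine le_trans ?_ (hlow (x C) (ε * diam C.1) (by have := hδ.trans_le hC; positivity) ?_)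
  · gcongr
  · nlinarith [diam_sphere2_le_two C.1]

theorem countable_peripheralCircles {S : Set ↥Sphere2}
    (hq : UniformQuasicircles {C | IsPeripheralCircle S C}) :
    Countable {C // IsPeripheralCircle S C} := by
  obtain ⟨ε, hε, hε1, x, hdisj, hx⟩ := exists_disjoint_balls hq
  exact hdisj.countable_of_isOpen_disjoint (fun C => isOpen_ball)
    fun C => nonempty_ball.2 (by have := (hx C).1; positivity)

theorem finite_setOf_mem {S : Set ↥Sphere2}
    (hq : UniformQuasicircles {C | IsPeripheralCircle S C}) (p : ↥Sphere2) :
    {C : {C // IsPeripheralCircle S C} | p ∈ C.1}.Finite := by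
  obtain ⟨ε, hε, hε1, D, hdisj, hD⟩ := exists_complementary_domains hq
  obtain ⟨c, K, hc, hK, hlow, hup⟩ := exists_ahlfors_bounds
  by_contra hinf
  set A : ℝ≥0∞ := K * 9 with hA
  set B : ℝ≥0∞ := c * ENNReal.ofReal ε ^ 2 with hB
  have hB0 : B ≠ 0 := mul_ne_zero hc (pow_ne_zero _ (ENNReal.ofReal_pos.2 hε).ne')
  have hAt : A ≠ ∞ := ENNReal.mul_ne_top hK (by simp)
  obtain ⟨n, hn⟩ := ENNReal.exists_nat_mul_gt hB0 hAt
  obtain ⟨t, ht, htn⟩ := Set.Infinite.exists_subset_card_eq hinf (n + 1)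
  have htne : t.Nonempty := Finset.card_pos.1 (by omega)
  obtain ⟨C₀, hC₀, hmin⟩ := t.exists_min_image (fun C => diam C.1) htne
  set r := diam C₀.1 with hr
  have hr0 : 0 < r := (hD C₀).2.1
  have hr2 : r ≤ 2 := diam_sphere2_le_two _
  have hex : ∀ C : ↥t, ∃ x, dist x p ≤ r ∧ ball x (ε * r) ⊆ D C.1 := fun C =>
    (hD C.1).2.2 p (ht C.2) r hr0 (hmin C.1 C.2)
  choose x hx hxD using hex
  have hsum : ∑ C : ↥t, sphereMeasure (ball (x C) (ε * r)) ≤ sphereMeasure (ball p (3 * r)) := by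
    rw [← measure_biUnion_finset]
    · refine measure_mono (iUnion₂_subset fun C _ y hy => ?_)
      rw [mem_ball] at hy ⊢
      nlinarith [dist_triangle y (x C) p, hx C]
    · intro C _ C' _ hne
      exact (hdisj fun h => hne (Subtype.ext h)).mono (hxD C) (hxD C')
    · exact fun C _ => measurableSet_ball
  have h1 : (n + 1 : ℕ) * (B * ENNReal.ofReal r ^ 2) ≤
      ∑ C : ↥t, sphereMeasure (ball (x C) (ε * r)) := by
    rw [← htn, ← Fintype.card_coe, ← nsmul_eq_mul, ← Finset.card_univ]
    refine Finset.card_nsmul_le_sum _ _ _ fun C _ => ?_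
    refine le_trans (le_of_eq ?_) (hlow (x C) (ε * r) (by positivity) (by nlinarith))
    rw [hB, ENNReal.ofReal_mul hε.le, mul_pow, mul_assoc]
  have h2 : sphereMeasure (ball p (3 * r)) ≤ A * ENNReal.ofReal r ^ 2 := by
    refine (hup p (3 * r) (by positivity)).trans_eq ?_
    rw [hA, ENNReal.ofReal_mul (by norm_num), mul_pow, mul_assoc]
    norm_num
  have h3 := h1.trans (hsum.trans h2)
  rw [← mul_assoc] at h3
  have h4 := (ENNReal.mul_le_mul_iff_left (pow_ne_zero _ (ENNReal.ofReal_pos.2 hr0).ne')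
    (by simp)).1 h3
  have h5 : (n : ℝ≥0∞) * B ≤ ((n + 1 : ℕ) : ℝ≥0∞) * B := by
    gcongr
    omega
  exact (hn.trans_le (h5.trans h4)).false

theorem ENNReal.sum_mul_sq_le_sum_sq_mul_sum_sq {ι : Type*} (s : Finset ι) (f g : ι → ℝ≥0∞) :
    (∑ i ∈ s, f i * g i) ^ 2 ≤ (∑ i ∈ s, f i ^ 2) * ∑ i ∈ s, g i ^ 2 := by
  have h := ENNReal.inner_le_Lp_mul_Lq s f g (p := 2) (q := 2) Real.HolderConjugate.two_two
  have h2 : ∀ t : ℝ≥0∞, (t ^ (1 / (2 : ℝ))) ^ 2 = t := by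
    intro t
    rw [← ENNReal.rpow_natCast, ← ENNReal.rpow_mul]
    norm_num
  calc (∑ i ∈ s, f i * g i) ^ 2 ≤ _ := pow_le_pow_left' h 2
    _ = _ := by
      rw [mul_pow, h2, h2]
      simp only [ENNReal.rpow_ofNat]

/-- The square of a finite sum is controlled by the sum over ordered pairs. -/
theorem ENNReal.sum_sq_le_two_mul_sum {ι : Type*} (s : Finset ι) (d : ι → ℝ) (f : ι → ℝ≥0∞) :
    (∑ i ∈ s, f i) ^ 2 ≤ 2 * ∑ i ∈ s, f i * ∑ j ∈ s with d i ≤ d j, f j := by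
  have h1 : ∑ i ∈ s, f i * ∑ j ∈ s with d i ≤ d j, f j =
      ∑ i ∈ s, ∑ j ∈ s, if d i ≤ d j then f i * f j else 0 := by
    refine Finset.sum_congr rfl fun i _ => ?_
    rw [Finset.mul_sum, Finset.sum_filter]
  have h2 : ∑ i ∈ s, ∑ j ∈ s, (if d i ≤ d j then f i * f j else 0) =
      ∑ i ∈ s, ∑ j ∈ s, if d j ≤ d i then f i * f j else 0 := by
    rw [Finset.sum_comm]
    simp only [mul_comm]
  rw [two_mul]
  refine le_of_le_of_eq ?_ (congrArg₂ (· + ·) h1 (h1.trans h2)).symm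
  rw [← Finset.sum_add_distrib, sq, Finset.sum_mul_sum]
  refine Finset.sum_le_sum fun i _ => ?_
  rw [← Finset.sum_add_distrib]
  refine Finset.sum_le_sum fun j _ => ?_
  rcases le_total (d i) (d j) with h | h
  · rw [if_pos h]
    exact le_self_add
  · rw [if_pos h]
    exact le_add_self

/-- The finite sum of multiples of indicator functions of balls. -/
noncomputable def ballSum {ι : Type*} (F : Finset ι) (x : ι → ↥Sphere2) (d : ι → ℝ)
    (b : ι → ℝ≥0∞) (t : ℝ) (y : ↥Sphere2) : ℝ≥0∞ :=
  ∑ i ∈ F, (ball (x i) (t * d i)).indicator (fun _ => b i) y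

theorem measurable_ballSum {ι : Type*} (F : Finset ι) (x : ι → ↥Sphere2) (d : ι → ℝ)
    (b : ι → ℝ≥0∞) (t : ℝ) : Measurable (ballSum F x d b t) :=
  Finset.measurable_sum _ fun _ _ => measurable_const.indicator measurableSet_ball

theorem exists_ballSum_sq_le {ε : ℝ} (hε : 0 < ε) (hε1 : ε ≤ 1) :
    ∃ K : ℝ≥0∞, K ≠ ∞ ∧ ∀ (ι : Type) (x : ι → ↥Sphere2) (d : ι → ℝ), (∀ i, 0 < d i) →
      (∀ i, d i ≤ 2) →
      Pairwise (fun i j => Disjoint (ball (x i) (ε * d i)) (ball (x j) (ε * d j))) →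
      ∀ (F : Finset ι) (a : ι → ℝ≥0∞) (t : ℝ), 1 ≤ t →
        (∫⁻ y, ballSum F x d (fun i => a i / ENNReal.ofReal (d i)) t y ^ 2 ∂sphereMeasure) ^ 2 ≤
          K * ENNReal.ofReal t ^ 4 * (∑ i ∈ F, a i ^ 2) *
            ∫⁻ y, ballSum F x d (fun i => a i / ENNReal.ofReal (d i)) (3 * t) y ^ 2
              ∂sphereMeasure := by
  obtain ⟨c, C, hc, hC, hlow, hup⟩ := exists_ahlfors_bounds
  set q : ℝ≥0∞ := min c 1 * ENNReal.ofReal ε ^ 2 with hq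
  have hq0 : q ≠ 0 := mul_ne_zero (lt_min (pos_iff_ne_zero.2 hc) one_pos).ne'
    (pow_ne_zero _ (ENNReal.ofReal_pos.2 hε).ne')
  have hqt : q ≠ ∞ := ENNReal.mul_ne_top (ne_top_of_le_ne_top ENNReal.one_ne_top (min_le_right _ _))
    (by simp)
  refine ⟨(2 * C) ^ 2 * q⁻¹, ENNReal.mul_ne_top (ENNReal.pow_ne_top
    (ENNReal.mul_ne_top (by simp) hC)) (ENNReal.inv_ne_top.2 hq0), ?_⟩
  intro ι x d hd0 hd2 hdisj F a t ht
  classical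
  have hdpos : ∀ i, ENNReal.ofReal (d i) ≠ 0 := fun i => (ENNReal.ofReal_pos.2 (hd0 i)).ne'
  set b : ι → ℝ≥0∞ := fun i => a i / ENNReal.ofReal (d i) with hb
  have hbd : ∀ i, b i * ENNReal.ofReal (d i) = a i := fun i =>
    ENNReal.div_mul_cancel (hdpos i) (by simp)
  let T : ι → ℝ≥0∞ := fun i => ∑ j ∈ F with
    d i ≤ d j ∧ (ball (x i) (t * d i) ∩ ball (x j) (t * d j)).Nonempty, b j
  have hpt : ∀ y, ballSum F x d b t y ^ 2 ≤
      2 * ∑ i ∈ F, (ball (x i) (t * d i)).indicator (fun _ => b i * T i) y := by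
    intro y
    refine (ENNReal.sum_sq_le_two_mul_sum F d _).trans ?_
    gcongr with i _
    by_cases hy : y ∈ ball (x i) (t * d i)
    · rw [indicator_of_mem hy, indicator_of_mem hy]
      gcongr
      simp only [T, Finset.sum_filter]
      refine Finset.sum_le_sum fun j _ => ?_
      by_cases hij : d i ≤ d j
      · by_cases hyj : y ∈ ball (x j) (t * d j)
        · rw [if_pos hij, if_pos ⟨hij, y, hy, hyj⟩, indicator_of_mem hyj]
        · rw [if_pos hij, indicator_of_notMem hyj]
          exact zero_le
      · rw [if_neg hij]
        exact zero_le
    · rw [indicator_of_notMem hy, indicator_of_notMem hy, zero_mul]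
  have hX : ∫⁻ y, ballSum F x d b t y ^ 2 ∂sphereMeasure ≤
      2 * C * ENNReal.ofReal t ^ 2 * ∑ i ∈ F, a i * (ENNReal.ofReal (d i) * T i) := by
    refine (lintegral_mono hpt).trans ?_
    rw [lintegral_const_mul' _ _ (by simp), lintegral_finsetSum _
      fun i _ => measurable_const.indicator measurableSet_ball, mul_assoc, mul_assoc]
    gcongr
    rw [Finset.mul_sum, Finset.mul_sum]
    gcongr with i _
    rw [lintegral_indicator measurableSet_ball, setLIntegral_const]
    have := hup (x i) (t * d i) (mul_pos (by linarith) (hd0 i))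
    calc b i * T i * sphereMeasure (ball (x i) (t * d i))
        ≤ b i * T i * (C * ENNReal.ofReal (t * d i) ^ 2) := by gcongr
      _ = C * (ENNReal.ofReal t ^ 2 * ((b i * ENNReal.ofReal (d i)) *
            (ENNReal.ofReal (d i) * T i))) := by
          rw [ENNReal.ofReal_mul (by linarith)]
          ring
      _ = _ := by rw [hbd]
  have hT : ∀ i ∈ F, ∀ y ∈ ball (x i) (ε * d i), T i ≤ ballSum F x d b (3 * t) y := by
    intro i _ y hy
    rw [ballSum]
    simp only [T, Finset.sum_filter]
    refine Finset.sum_le_sum fun j _ => ?_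
    split_ifs with hj
    · obtain ⟨hij, z, hz1, hz2⟩ := hj
      rw [mem_ball] at hy hz1 hz2
      rw [indicator_of_mem]
      rw [mem_ball]
      have h1 := dist_triangle4 y (x i) z (x j)
      rw [dist_comm (x i) z] at h1
      have h2 : t * d i ≤ t * d j := by gcongr
      nlinarith [hd0 i]
    · exact zero_le
  have hT2 : q * ∑ i ∈ F, (ENNReal.ofReal (d i) * T i) ^ 2 ≤
      ∫⁻ y, ballSum F x d b (3 * t) y ^ 2 ∂sphereMeasure := by
    calc q * ∑ i ∈ F, (ENNReal.ofReal (d i) * T i) ^ 2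
        ≤ ∑ i ∈ F, ∫⁻ y in ball (x i) (ε * d i),
            ballSum F x d b (3 * t) y ^ 2 ∂sphereMeasure := by
          rw [Finset.mul_sum]
          refine Finset.sum_le_sum fun i hi => ?_
          have h1 := hlow (x i) (ε * d i) (mul_pos hε (hd0 i)) (by nlinarith [hd0 i, hd2 i])
          calc q * (ENNReal.ofReal (d i) * T i) ^ 2
              = T i ^ 2 * (min c 1 * ENNReal.ofReal (ε * d i) ^ 2) := by
                rw [hq, ENNReal.ofReal_mul hε.le]
                ring
            _ ≤ T i ^ 2 * sphereMeasure (ball (x i) (ε * d i)) := by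
                gcongr
                refine le_trans ?_ h1
                gcongr
                exact min_le_left _ _
            _ = ∫⁻ y in ball (x i) (ε * d i), T i ^ 2 ∂sphereMeasure :=
                (setLIntegral_const _ _).symm
            _ ≤ _ := setLIntegral_mono' measurableSet_ball fun y hy => by
                gcongr
                exact hT i hi y hy
      _ = ∫⁻ y in ⋃ i ∈ F, ball (x i) (ε * d i),
            ballSum F x d b (3 * t) y ^ 2 ∂sphereMeasure :=
          (lintegral_biUnion_finset (fun i _ j _ hij => hdisj hij)
            (fun i _ => measurableSet_ball) _).symm
      _ ≤ _ := setLIntegral_le_lintegral _ _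
  have hT3 : ∑ i ∈ F, (ENNReal.ofReal (d i) * T i) ^ 2 ≤
      q⁻¹ * ∫⁻ y, ballSum F x d b (3 * t) y ^ 2 ∂sphereMeasure := by
    rw [← ENNReal.div_eq_inv_mul, ENNReal.le_div_iff_mul_le (Or.inl hq0) (Or.inl hqt), mul_comm]
    exact hT2
  calc (∫⁻ y, ballSum F x d b t y ^ 2 ∂sphereMeasure) ^ 2
      ≤ (2 * C * ENNReal.ofReal t ^ 2 * ∑ i ∈ F, a i * (ENNReal.ofReal (d i) * T i)) ^ 2 := by
        gcongr
    _ = (2 * C * ENNReal.ofReal t ^ 2) ^ 2 *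
          (∑ i ∈ F, a i * (ENNReal.ofReal (d i) * T i)) ^ 2 := by ring
    _ ≤ (2 * C * ENNReal.ofReal t ^ 2) ^ 2 * ((∑ i ∈ F, a i ^ 2) *
          (q⁻¹ * ∫⁻ y, ballSum F x d b (3 * t) y ^ 2 ∂sphereMeasure)) := by
        gcongr
        exact (ENNReal.sum_mul_sq_le_sum_sq_mul_sum_sq F _ _).trans (by gcongr)
    _ = _ := by ring

/-- Bojarski's lemma: the `L²` norm of a sum of multiples of indicator functions of inflated balls
is controlled by that of the sum over the original pairwise disjoint balls. -/
theorem exists_lintegral_tsum_indicator_sq_le {ε : ℝ} (hε : 0 < ε) (hε1 : ε ≤ 1) :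
    ∃ K : ℝ≥0∞, K ≠ ∞ ∧ ∀ (ι : Type) [Countable ι] (x : ι → ↥Sphere2) (d : ι → ℝ), (∀ i, 0 < d i) →
      (∀ i, d i ≤ 2) →
      Pairwise (fun i j => Disjoint (ball (x i) (ε * d i)) (ball (x j) (ε * d j))) →
      ∀ a : ι → ℝ≥0∞,
        ∫⁻ y, (∑' i, (ball (x i) (4 * d i)).indicator
          (fun _ => a i / ENNReal.ofReal (d i)) y) ^ 2 ∂sphereMeasure ≤ K * ∑' i, a i ^ 2 := by
  obtain ⟨K, hK, hmain⟩ := exists_ballSum_sq_le hε hε1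
  set K' : ℝ≥0∞ := K * 256 * 81 with hK'
  refine ⟨K' + 1, ENNReal.add_ne_top.2 ⟨ENNReal.mul_ne_top (ENNReal.mul_ne_top hK (by simp))
    (by simp), by simp⟩, ?_⟩
  intro ι _ x d hd0 hd2 hdisj a
  by_cases hA : ∑' i, a i ^ 2 = ∞
  · rw [hA, ENNReal.mul_top (by simp)]
    exact le_top
  have ha : ∀ i, a i ≠ ∞ := by
    intro i hi
    refine hA (top_le_iff.1 (le_trans ?_ (ENNReal.le_tsum i)))
    rw [hi]
    simp
  have hfin : ∀ F : Finset ι, ∫⁻ y, ballSum F x d (fun i => a i / ENNReal.ofReal (d i)) 4 y ^ 2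
      ∂sphereMeasure ≤ K' * ∑ i ∈ F, a i ^ 2 := by
    intro F
    set X : ℕ → ℝ≥0∞ := fun n => ∫⁻ y, ballSum F x d (fun i => a i / ENNReal.ofReal (d i))
      (4 * 3 ^ n) y ^ 2 ∂sphereMeasure with hXdef
    set Z : ℝ≥0∞ := ⨆ n, X n / 81 ^ n with hZ
    have hp0 : ∀ n : ℕ, (81 : ℝ≥0∞) ^ n ≠ 0 := fun n => pow_ne_zero _ (by simp)
    have hpt : ∀ n : ℕ, (81 : ℝ≥0∞) ^ n ≠ ∞ := fun n => ENNReal.pow_ne_top (by simp)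
    have hstep : ∀ n, X n ^ 2 ≤ K * 256 * (∑ i ∈ F, a i ^ 2) * X (n + 1) * 81 ^ n := by
      intro n
      have h := hmain ι x d hd0 hd2 hdisj F a (4 * 3 ^ n)
        (by nlinarith [one_le_pow₀ (M₀ := ℝ) (n := n) (show (1 : ℝ) ≤ 3 by norm_num)])
      rw [show (3 : ℝ) * (4 * 3 ^ n) = 4 * 3 ^ (n + 1) by ring] at h
      refine h.trans_eq ?_
      have h1 : ENNReal.ofReal (4 * 3 ^ n) ^ 4 = 256 * 81 ^ n := by
        rw [ENNReal.ofReal_mul (by norm_num), ENNReal.ofReal_pow (by norm_num), mul_pow, ← pow_mul,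
          mul_comm n 4, pow_mul]
        norm_num
      rw [h1]
      simp only [hXdef]
      ring
    have hXZ : ∀ n, X n ≤ Z * 81 ^ n := fun n => by
      rw [← ENNReal.div_le_iff (hp0 n) (hpt n)]
      exact le_iSup (fun n => X n / 81 ^ n) n
    have hZt : Z ≠ ∞ := by
      have hM : (∑ i ∈ F, a i / ENNReal.ofReal (d i)) ^ 2 * sphereMeasure univ ≠ ∞ := by
        refine ENNReal.mul_ne_top (ENNReal.pow_ne_top (ENNReal.sum_ne_top.2 fun i _ => ?_))
          (measure_ne_top _ _)
        exact ENNReal.div_ne_top (ha i) (ENNReal.ofReal_pos.2 (hd0 i)).ne'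
      refine ne_top_of_le_ne_top hM (iSup_le fun n => ?_)
      refine (ENNReal.div_le_of_le_mul ?_)
      calc X n ≤ ∫⁻ y, (∑ i ∈ F, a i / ENNReal.ofReal (d i)) ^ 2 ∂sphereMeasure := by
            refine lintegral_mono fun y => pow_le_pow_left' (Finset.sum_le_sum fun i _ => ?_) 2
            exact indicator_le_self _ _ _
        _ = (∑ i ∈ F, a i / ENNReal.ofReal (d i)) ^ 2 * sphereMeasure univ := lintegral_const _
        _ ≤ _ := le_mul_of_one_le_right zero_le (one_le_pow₀ (by norm_num))
    have hZ2 : Z ^ 2 ≤ K' * (∑ i ∈ F, a i ^ 2) * Z := by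
      rw [hZ, ENNReal.iSup_pow, ← hZ]
      refine iSup_le fun n => ?_
      rw [ENNReal.div_eq_inv_mul, mul_pow, ← ENNReal.inv_pow, ← ENNReal.div_eq_inv_mul,
        ENNReal.div_le_iff (pow_ne_zero _ (hp0 n)) (ENNReal.pow_ne_top (hpt n))]
      calc X n ^ 2 ≤ K * 256 * (∑ i ∈ F, a i ^ 2) * X (n + 1) * 81 ^ n := hstep n
        _ ≤ K * 256 * (∑ i ∈ F, a i ^ 2) * (Z * 81 ^ (n + 1)) * 81 ^ n := by
          gcongr
          exact hXZ _
        _ = _ := by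
          rw [hK']
          ring
    have hZle : Z ≤ K' * ∑ i ∈ F, a i ^ 2 := by
      by_cases h0 : Z = 0
      · rw [h0]
        exact zero_le
      · rw [sq] at hZ2
        exact (ENNReal.mul_le_mul_iff_left h0 hZt).1 hZ2
    have h0 := hXZ 0
    simp only [hXdef, pow_zero, mul_one] at h0
    exact h0.trans hZle
  have hsup : ∀ y, (∑' i, (ball (x i) (4 * d i)).indicator
      (fun _ => a i / ENNReal.ofReal (d i)) y) ^ 2 =
      ⨆ F : Finset ι, ballSum F x d (fun i => a i / ENNReal.ofReal (d i)) 4 y ^ 2 := by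
    intro y
    rw [ENNReal.tsum_eq_iSup_sum, ENNReal.iSup_pow]
    rfl
  simp_rw [hsup]
  rw [lintegral_iSup_directed_of_measurable
    (fun F => (measurable_ballSum F x d _ 4).pow_const 2)]
  · refine iSup_le fun F => (hfin F).trans ?_
    gcongr
    · exact le_self_add
    · exact ENNReal.sum_le_tsum F
  · refine Monotone.directed_le fun F G hFG y => ?_
    exact pow_le_pow_left' (Finset.sum_le_sum_of_subset hFG) 2

theorem exists_first_hit {φ : ℝ → ℝ} {p q m : ℝ} (hpq : p ≤ q) (hφ : ContinuousOn φ (Icc p q))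
    (hp : φ p ≤ m) (hq : m ≤ φ q) :
    ∃ c ∈ Icc p q, φ c = m ∧ ∀ t ∈ Icc p c, φ t ≤ m := by
  have hcl : IsCompact (Icc p q ∩ φ ⁻¹' {m}) :=
    isCompact_Icc.of_isClosed_subset (hφ.preimage_isClosed_of_isClosed isClosed_Icc
      isClosed_singleton) inter_subset_left
  have hne : (Icc p q ∩ φ ⁻¹' {m}).Nonempty := by
    obtain ⟨c, hc, hcm⟩ := intermediate_value_Icc hpq hφ ⟨hp, hq⟩
    exact ⟨c, hc, hcm⟩
  obtain ⟨c, ⟨hc, hcm⟩, hleast⟩ := hcl.exists_isLeast hne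
  refine ⟨c, hc, hcm, fun t ht => ?_⟩
  by_contra! hlt
  have htq : t ≤ q := ht.2.trans hc.2
  obtain ⟨s, hs, hsm⟩ := intermediate_value_Icc ht.1 (hφ.mono (Icc_subset_Icc_right htq))
    ⟨hp, hlt.le⟩
  have h1 : c ≤ s := hleast ⟨⟨hs.1, hs.2.trans htq⟩, hsm⟩
  have h2 : t = c := le_antisymm ht.2 (h1.trans hs.2)
  rw [h2] at hlt
  exact hlt.ne' hcm

theorem exists_last_hit {φ : ℝ → ℝ} {p q m : ℝ} (hpq : p ≤ q) (hφ : ContinuousOn φ (Icc p q))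
    (hp : m ≤ φ p) (hq : φ q ≤ m) :
    ∃ c ∈ Icc p q, φ c = m ∧ ∀ t ∈ Icc c q, φ t ≤ m := by
  obtain ⟨c, hc, hcm, hle⟩ := exists_first_hit (φ := fun t => φ (-t)) (neg_le_neg hpq)
    (hφ.comp continuous_neg.continuousOn fun t ht => ⟨by linarith [ht.2], by linarith [ht.1]⟩)
    (by simpa using hq) (by simpa using hp)
  refine ⟨-c, ⟨by linarith [hc.2], by linarith [hc.1]⟩, hcm, fun t ht => ?_⟩
  have := hle (-t) ⟨by linarith [ht.2], by linarith [ht.1]⟩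
  simpa using this

theorem mul_edist_le_arcIntegralOn {f : ℝ → ↥Sphere2} {a b c c' : ℝ} (hac : a ≤ c) (hcc : c ≤ c')
    (hcb : c' ≤ b) (hfin : eVariationOn f (Icc a b) < ∞) {B : Set ↥Sphere2}
    (hB : ∀ t ∈ Icc c c', f t ∈ B) (w : ℝ≥0∞) :
    w * edist (f c) (f c') ≤ arcIntegralOn (B.indicator fun _ => w) f a b := by
  have hmono : ∀ {s t}, s ≤ t → eVariationOn f (Icc a s) ≤ eVariationOn f (Icc a t) :=
    fun h => eVariationOn.mono f (Icc_subset_Icc_right h)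
  have hfin2 : eVariationOn f (Icc a c') ≠ ∞ := ((hmono hcb).trans_lt hfin).ne
  have hfin1 : eVariationOn f (Icc a c) ≠ ∞ := ((hmono (hcc.trans hcb)).trans_lt hfin).ne
  set s := (eVariationOn f (Icc a c)).toReal with hs
  set s' := (eVariationOn f (Icc a c')).toReal with hs'
  have hs0 : 0 ≤ s := ENNReal.toReal_nonneg
  have hsL : s' ≤ (eVariationOn f (Icc a b)).toReal := ENNReal.toReal_mono hfin.ne (hmono hcb)
  have hsub : Ioo s s' ⊆ Ico 0 (eVariationOn f (Icc a b)).toReal :=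
    fun u hu => ⟨hs0.trans hu.1.le, hu.2.trans_le hsL⟩
  have hmem : ∀ u ∈ Ioo s s', f (sInf {t | t ∈ Icc a b ∧
      ENNReal.ofReal u ≤ eVariationOn f (Icc a t)}) ∈ B := by
    intro u hu
    have hc'mem : c' ∈ {t | t ∈ Icc a b ∧ ENNReal.ofReal u ≤ eVariationOn f (Icc a t)} :=
      ⟨⟨hac.trans hcc, hcb⟩, (ENNReal.ofReal_le_iff_le_toReal hfin2).2 hu.2.le⟩
    have hlb : ∀ t ∈ {t | t ∈ Icc a b ∧ ENNReal.ofReal u ≤ eVariationOn f (Icc a t)}, c ≤ t := by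
      rintro t ⟨-, ht⟩
      by_contra! htc
      have h1 := ht.trans (hmono htc.le)
      rw [ENNReal.ofReal_le_iff_le_toReal hfin1] at h1
      exact (hu.1.trans_le h1).false
    exact hB _ ⟨le_csInf ⟨c', hc'mem⟩ hlb, csInf_le ⟨c, hlb⟩ hc'mem⟩
  have hadd : eVariationOn f (Icc a c) + eVariationOn f (Icc c c') = eVariationOn f (Icc a c') := by
    have := eVariationOn.Icc_add_Icc f (s := univ) hac hcc (mem_univ c)
    simpa using this
  have hedist : edist (f c) (f c') ≤ ENNReal.ofReal (s' - s) := by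
    rw [ENNReal.ofReal_sub _ hs0, hs, hs', ENNReal.ofReal_toReal hfin1, ENNReal.ofReal_toReal hfin2,
      ← hadd, ENNReal.add_sub_cancel_left hfin1]
    exact eVariationOn.edist_le f (left_mem_Icc.2 hcc) (right_mem_Icc.2 hcc)
  calc w * edist (f c) (f c') ≤ w * ENNReal.ofReal (s' - s) := by gcongr
    _ = ∫⁻ _ in Ioo s s', w := by rw [setLIntegral_const, Real.volume_Ioo]
    _ ≤ ∫⁻ u in Ioo s s', B.indicator (fun _ => w) (f (sInf {t | t ∈ Icc a b ∧
          ENNReal.ofReal u ≤ eVariationOn f (Icc a t)})) :=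
        setLIntegral_mono' measurableSet_Ioo fun u hu => by rw [indicator_of_mem (hmem u hu)]
    _ ≤ _ := lintegral_mono_set hsub

theorem sum_arcIntegralOn_le {ι : Type*} (G : Finset ι) (ρ : ι → ↥Sphere2 → ℝ≥0∞)
    (f : ℝ → ↥Sphere2) (a b : ℝ) :
    ∑ i ∈ G, arcIntegralOn (ρ i) f a b ≤ arcIntegralOn (fun y => ∑ i ∈ G, ρ i y) f a b := by
  classical
  induction G using Finset.induction_on with
  | empty => simp
  | insert i G hi ih =>
    simp only [Finset.sum_insert hi]
    exact (add_le_add_right ih _).trans (le_lintegral_add _ _)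

theorem arcIntegralOn_mono {ρ ρ' : ↥Sphere2 → ℝ≥0∞} (h : ∀ y, ρ y ≤ ρ' y)
    (f : ℝ → ↥Sphere2) (a b : ℝ) : arcIntegralOn ρ f a b ≤ arcIntegralOn ρ' f a b :=
  lintegral_mono fun _ => h _

theorem SpherePath.lineIntegral_mono (γ : SpherePath) {ρ ρ' : ↥Sphere2 → ℝ≥0∞}
    (h : ∀ y, ρ y ≤ ρ' y) : γ.lineIntegral ρ ≤ γ.lineIntegral ρ' :=
  iSup_mono fun a => iSup_mono fun b => iSup_mono fun _ => arcIntegralOn_mono h γ.toFun a b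

theorem SpherePath.arcIntegralOn_le_lineIntegral (γ : SpherePath) (ρ : ↥Sphere2 → ℝ≥0∞) {a b : ℝ}
    (h : Icc a b ⊆ γ.I) : arcIntegralOn ρ γ.toFun a b ≤ γ.lineIntegral ρ := by
  refine le_iSup_of_le a (le_iSup_of_le b ?_)
  rw [iSup_pos h]

theorem SpherePath.ordConnected (γ : SpherePath) : γ.I.OrdConnected := by
  obtain ⟨a, b, -, h | h | h | h⟩ := γ.hI <;> rw [h]
  exacts [ordConnected_Icc, ordConnected_Ico, ordConnected_Ioc, ordConnected_Ioo]

theorem SpherePath.nonempty (γ : SpherePath) : γ.I.Nonempty := by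
  obtain ⟨a, b, hab, h | h | h | h⟩ := γ.hI <;> rw [h]
  exacts [nonempty_Icc.2 hab.le, nonempty_Ico.2 hab, nonempty_Ioc.2 hab, nonempty_Ioo.2 hab]

/-- A curve that crosses the annulus between the balls of radii `2 * d` and `4 * d` has length at
least `d` in the larger ball. -/
theorem le_arcIntegralOn_of_crossing {f : ℝ → ↥Sphere2} {a b : ℝ} (hf : ContinuousOn f (Icc a b))
    (hfin : eVariationOn f (Icc a b) < ∞) {x : ↥Sphere2} {d : ℝ} (hd : 0 < d) {t t' : ℝ}
    (ht : t ∈ Icc a b) (ht' : t' ∈ Icc a b) (hx : dist (f t) x ≤ 2 * d)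
    (hx' : 4 * d ≤ dist (f t') x) (w : ℝ≥0∞) :
    w ≤ arcIntegralOn ((ball x (4 * d)).indicator fun _ => w / ENNReal.ofReal d) f a b := by
  have hd0 : ENNReal.ofReal d ≠ 0 := (ENNReal.ofReal_pos.2 hd).ne'
  have hφ : ContinuousOn (fun t => dist (f t) x) (Icc a b) :=
    (continuous_id.dist continuous_const).comp_continuousOn hf
  have key : ∀ c c', dist (f c) (f c') ≥ d → w ≤ w / ENNReal.ofReal d * edist (f c) (f c') := by
    intro c c' h
    rw [edist_dist]
    calc w = w / ENNReal.ofReal d * ENNReal.ofReal d := (ENNReal.div_mul_cancel hd0 (by simp)).symm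
      _ ≤ _ := by gcongr
  rcases le_total t t' with h | h
  · obtain ⟨c, hc, hcm, hle⟩ := exists_first_hit (m := 3 * d) h
      (hφ.mono (Icc_subset_Icc ht.1 ht'.2)) (by linarith) (by linarith)
    refine (key t c ?_).trans (mul_edist_le_arcIntegralOn ht.1 hc.1 (hc.2.trans ht'.2) hfin
      (fun s hs => ?_) _)
    · linarith [dist_triangle_left (f c) x (f t)]
    · rw [mem_ball]
      linarith [hle s hs]
  · obtain ⟨c, hc, hcm, hle⟩ := exists_last_hit (m := 3 * d) h
      (hφ.mono (Icc_subset_Icc ht'.1 ht.2)) (by linarith) (by linarith)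
    refine (key c t ?_).trans (mul_edist_le_arcIntegralOn (ht'.1.trans hc.1) hc.2 ht.2 hfin
      (fun s hs => ?_) _)
    · linarith [dist_triangle (f c) (f t) x]
    · rw [mem_ball]
      linarith [hle s hs]

theorem SpherePath.tsum_le_lineIntegral (γ : SpherePath) (hγ : γ.LocRectifiable) {ι : Type*}
    (x : ι → ↥Sphere2) (d : ι → ℝ) (hd : ∀ i, 0 < d i) (w : ι → ℝ≥0∞) (s : Set ι)
    (hs : ∀ i ∈ s, (∃ t ∈ γ.I, dist (γ.toFun t) (x i) ≤ 2 * d i) ∧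
      ∃ t ∈ γ.I, 4 * d i ≤ dist (γ.toFun t) (x i)) :
    ∑' i : ↥s, w i ≤ γ.lineIntegral fun y => ∑' i, (ball (x i) (4 * d i)).indicator
      (fun _ => w i / ENNReal.ofReal (d i)) y := by
  classical
  rw [ENNReal.tsum_eq_iSup_sum]
  refine iSup_le fun G => ?_
  choose p hpI hp using fun i : ↥s => (hs i i.2).1
  choose p' hp'I hp' using fun i : ↥s => (hs i i.2).2
  obtain ⟨t₀, ht₀⟩ := γ.nonempty
  let P : Finset ℝ := insert t₀ (G.image p ∪ G.image p')
  have hPI : ∀ t ∈ P, t ∈ γ.I := by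
    intro t ht
    simp only [P, Finset.mem_insert, Finset.mem_union, Finset.mem_image] at ht
    rcases ht with rfl | ⟨i, -, rfl⟩ | ⟨i, -, rfl⟩
    exacts [ht₀, hpI i, hp'I i]
  have hP : P.Nonempty := Finset.insert_nonempty _ _
  have hsub : Icc (P.min' hP) (P.max' hP) ⊆ γ.I :=
    γ.ordConnected.out (hPI _ (P.min'_mem hP)) (hPI _ (P.max'_mem hP))
  have hmem : ∀ t ∈ P, t ∈ Icc (P.min' hP) (P.max' hP) := fun t ht =>
    ⟨P.min'_le t ht, P.le_max' t ht⟩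
  calc ∑ i ∈ G, w i ≤ ∑ i ∈ G, arcIntegralOn ((ball (x i) (4 * d i)).indicator
        fun _ => w i / ENNReal.ofReal (d i)) γ.toFun (P.min' hP) (P.max' hP) := by
        refine Finset.sum_le_sum fun i hi => ?_
        refine le_arcIntegralOn_of_crossing (γ.cont.mono hsub) (hγ _ _ hsub) (hd i)
          (hmem (p i) ?_) (hmem (p' i) ?_) (hp i) (hp' i) _
        · simp only [P, Finset.mem_insert, Finset.mem_union]
          exact Or.inr (Or.inl (Finset.mem_image_of_mem _ hi))
        · simp only [P, Finset.mem_insert, Finset.mem_union]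
          exact Or.inr (Or.inr (Finset.mem_image_of_mem _ hi))
    _ ≤ _ := sum_arcIntegralOn_le G _ _ _ _
    _ ≤ arcIntegralOn (fun y => ∑' i, (ball (x i) (4 * d i)).indicator
          (fun _ => w i / ENNReal.ofReal (d i)) y) γ.toFun (P.min' hP) (P.max' hP) := by
        refine arcIntegralOn_mono (fun y => ?_) _ _ _
        refine (ENNReal.sum_le_tsum G).trans ?_
        exact ENNReal.tsum_comp_le_tsum_of_injective Subtype.val_injective
          fun i => (ball (x i) (4 * d i)).indicator (fun _ => w i / ENNReal.ofReal (d i)) y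
    _ ≤ _ := γ.arcIntegralOn_le_lineIntegral _ hsub

/-- All but finitely many of the peripheral circles met by a path are crossed by it at their own
scale. -/
theorem exists_finite_forall_crossing {S : Set ↥Sphere2}
    (hq : UniformQuasicircles {C | IsPeripheralCircle S C})
    {x : {C // IsPeripheralCircle S C} → ↥Sphere2}
    (hx : ∀ C, C.1 ⊆ closedBall (x C) (2 * diam C.1)) (γ : SpherePath) :
    ∃ L : Finset {C // IsPeripheralCircle S C}, ∀ C ∉ L, (γ.image ∩ C.1).Nonempty →
      (∃ t ∈ γ.I, dist (γ.toFun t) (x C) ≤ 2 * diam C.1) ∧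
      ∃ t ∈ γ.I, 4 * diam C.1 ≤ dist (γ.toFun t) (x C) := by
  obtain ⟨t₀, ht₀⟩ := γ.nonempty
  by_cases hconst : ∀ t ∈ γ.I, γ.toFun t = γ.toFun t₀
  · refine ⟨(finite_setOf_mem hq (γ.toFun t₀)).toFinset, fun C hC => ?_⟩
    rintro ⟨_, ⟨t, ht, rfl⟩, htC⟩
    rw [hconst t ht] at htC
    exact (hC ((finite_setOf_mem hq _).mem_toFinset.2 htC)).elim
  · push Not at hconst
    obtain ⟨t₁, ht₁, hne⟩ := hconst
    have hδ : 0 < dist (γ.toFun t₁) (γ.toFun t₀) / 8 := by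
      have := dist_pos.2 hne
      positivity
    refine ⟨(finite_setOf_le_diam hq hδ).toFinset, fun C hC => ?_⟩
    rintro ⟨_, ⟨t, ht, rfl⟩, htC⟩
    refine ⟨⟨t, ht, hx C htC⟩, ?_⟩
    have hlt : diam C.1 < dist (γ.toFun t₁) (γ.toFun t₀) / 8 := by
      by_contra! hle
      exact hC ((Finite.mem_toFinset _).2 hle)
    by_contra! hcon
    linarith [hcon t₀ ht₀, hcon t₁ ht₁, dist_triangle_right (γ.toFun t₁) (γ.toFun t₀) (x C)]

theorem pathMassSum_le {S : Set ↥Sphere2} (ρ : Set ↥Sphere2 → ℝ≥0∞) (γ : SpherePath)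
    (L : Finset {C // IsPeripheralCircle S C}) :
    pathMassSum S ρ γ ≤ ∑ C ∈ L, ρ C.1 +
      ∑' C : ↥{C : {C // IsPeripheralCircle S C} | C ∉ L ∧ (γ.image ∩ C.1).Nonempty}, ρ C.1.1 := by
  classical
  set s := {C : {C // IsPeripheralCircle S C} | C ∉ L ∧ (γ.image ∩ C.1).Nonempty} with hs
  set M := {C : {C // IsPeripheralCircle S C} | (γ.image ∩ C.1).Nonempty} with hM
  let e : {C : Set ↥Sphere2 // IsPeripheralCircle S C ∧ (γ.image ∩ C).Nonempty} →
    {C // IsPeripheralCircle S C} := fun C => ⟨C.1, C.2.1⟩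
  have he : Function.Injective e := fun C C' h => Subtype.ext (congrArg (fun z => z.1) h)
  calc pathMassSum S ρ γ = ∑' C, M.indicator (fun C => ρ C.1) (e C) :=
        tsum_congr fun C => (indicator_of_mem (show e C ∈ M from C.2.2)
          (fun C : {C // IsPeripheralCircle S C} => ρ C.1)).symm
    _ ≤ ∑' C, M.indicator (fun C => ρ C.1) C := ENNReal.tsum_comp_le_tsum_of_injective he _
    _ ≤ ∑' C, ((L : Set _).indicator (fun C => ρ C.1) C + s.indicator (fun C => ρ C.1) C) := by
        refine ENNReal.tsum_le_tsum fun C => ?_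
        by_cases hCM : C ∈ M
        · rw [indicator_of_mem hCM]
          by_cases hCL : C ∈ L
          · rw [indicator_of_mem (show C ∈ (L : Set _) from hCL)]
            exact le_self_add
          · rw [indicator_of_mem (show C ∈ s from ⟨hCL, hCM⟩)]
            exact le_add_self
        · rw [indicator_of_notMem hCM]
          exact zero_le
    _ = _ := by
        rw [ENNReal.tsum_add, ← tsum_subtype, ← tsum_subtype, ← Finset.tsum_subtype']

/-- The sum over finitely many circles is controlled by the total mass. -/
theorem sum_sq_le_card_mul_carpetMass {S : Set ↥Sphere2} (ρ : Set ↥Sphere2 → ℝ≥0∞)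
    (L : Finset {C // IsPeripheralCircle S C}) :
    (∑ C ∈ L, ρ C.1) ^ 2 ≤ L.card * carpetMass S ρ := by
  have h := ENNReal.sum_mul_sq_le_sum_sq_mul_sum_sq L (fun _ => 1) fun C => ρ C.1
  simp only [one_mul, one_pow, Finset.sum_const, nsmul_eq_mul, mul_one] at h
  refine h.trans ?_
  gcongr
  exact ENNReal.sum_le_tsum L

theorem conformalModulus_le_lintegral {Γ : Set SpherePath} {ρ : ↥Sphere2 → ℝ≥0∞}
    (hρ : Measurable ρ) (h : ∀ γ ∈ Γ, γ.LocRectifiable → 1 ≤ γ.lineIntegral ρ) :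
    conformalModulus Γ ≤ ∫⁻ x, ρ x ^ 2 ∂sphereMeasure :=
  iInf_le_of_le ρ (iInf_le_of_le hρ (iInf_le_of_le h le_rfl))

/-- Countably many densities, of which each path admits one, may be combined into one. -/
theorem conformalModulus_le_tsum {Γ : Set SpherePath} (ρ : ℕ → ↥Sphere2 → ℝ≥0∞)
    (hρ : ∀ n, Measurable (ρ n))
    (h : ∀ γ ∈ Γ, γ.LocRectifiable → ∃ n, 1 ≤ γ.lineIntegral (ρ n)) :
    conformalModulus Γ ≤ ∑' n, ∫⁻ x, ρ n x ^ 2 ∂sphereMeasure := by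
  refine (conformalModulus_le_lintegral (ρ := fun y => ⨆ n, ρ n y) (Measurable.iSup hρ) ?_).trans ?_
  · intro γ hγ hrect
    obtain ⟨n, hn⟩ := h γ hγ hrect
    exact hn.trans (γ.lineIntegral_mono fun y => le_iSup (fun n => ρ n y) n)
  · rw [← lintegral_tsum fun n => ((hρ n).pow_const 2).aemeasurable]
    refine lintegral_mono fun y => ?_
    rw [ENNReal.iSup_pow]
    exact iSup_le fun n => ENNReal.le_tsum (f := fun n => ρ n y ^ 2) n

theorem exists_density_of_conformalModulus_eq_zero {Γ : Set SpherePath}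
    (h : conformalModulus Γ = 0) {δ : ℝ≥0∞} (hδ : 0 < δ) :
    ∃ ρ : ↥Sphere2 → ℝ≥0∞, Measurable ρ ∧
      (∀ γ ∈ Γ, γ.LocRectifiable → 1 ≤ γ.lineIntegral ρ) ∧
      ∫⁻ x, ρ x ^ 2 ∂sphereMeasure < δ := by
  rw [← h, conformalModulus] at hδ
  simp only [iInf_lt_iff] at hδ
  obtain ⟨ρ, hρ, hadm, hlt⟩ := hδ
  exact ⟨ρ, hρ, hadm, hlt⟩

/-- A mass distribution on the peripheral circles induces a density on the sphere, of comparable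
energy, whose line integrals dominate the path sums up to finitely many circles. -/
theorem exists_density_of_mass {S : Set ↥Sphere2}
    (hq : UniformQuasicircles {C | IsPeripheralCircle S C}) :
    ∃ K : ℝ≥0∞, K ≠ ∞ ∧ ∃ G : (Set ↥Sphere2 → ℝ≥0∞) → ↥Sphere2 → ℝ≥0∞,
      (∀ ρ, Measurable (G ρ) ∧ ∫⁻ y, G ρ y ^ 2 ∂sphereMeasure ≤ K * carpetMass S ρ) ∧
      ∀ γ : SpherePath, γ.LocRectifiable → ∃ L : Finset {C // IsPeripheralCircle S C},
        ∀ ρ, pathMassSum S ρ γ ≤ ∑ C ∈ L, ρ C.1 + γ.lineIntegral (G ρ) := by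
  have := countable_peripheralCircles hq
  obtain ⟨ε, hε, hε1, x, hdisj, hx⟩ := exists_disjoint_balls hq
  obtain ⟨K, hK, hbound⟩ := exists_lintegral_tsum_indicator_sq_le hε hε1
  refine ⟨K, hK, fun ρ y => ∑' C : {C // IsPeripheralCircle S C},
    (ball (x C) (4 * diam C.1)).indicator (fun _ => ρ C.1 / ENNReal.ofReal (diam C.1)) y,
    fun ρ => ⟨?_, ?_⟩, fun γ hγ => ?_⟩
  · exact Measurable.tsum fun C => measurable_const.indicator measurableSet_ball
  · exact hbound _ x (fun C => diam C.1) (fun C => (hx C).1) (fun C => diam_sphere2_le_two _) hdisj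
      fun C => ρ C.1
  · obtain ⟨L, hL⟩ := exists_finite_forall_crossing hq (fun C => (hx C).2) γ
    refine ⟨L, fun ρ => (pathMassSum_le ρ γ L).trans (add_le_add_right ?_ _)⟩
    exact γ.tsum_le_lineIntegral hγ x (fun C => diam C.1) (fun C => (hx C).1) (fun C => ρ C.1) _
      fun C hC => hL C hC.1 hC.2

theorem exists_mass_of_carpetModulus_eq_zero {S : Set ↥Sphere2} {Γ : Set SpherePath}
    (h : carpetModulus S Γ = 0) {δ : ℝ≥0∞} (hδ : 0 < δ) :
    ∃ ρ : Set ↥Sphere2 → ℝ≥0∞, CarpetAdmissible S Γ ρ ∧ carpetMass S ρ < δ := by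
  rw [← h, carpetModulus] at hδ
  simpa only [iInf_lt_iff, exists_prop] using hδ

/-- A path outside the exceptional family is detected by the density induced by `2ρ`, once the mass
of `ρ` is small compared with the number of circles neglected. -/
theorem one_le_of_pathMassSum {S : Set ↥Sphere2} {ρ : Set ↥Sphere2 → ℝ≥0∞} {γ : SpherePath}
    {L : Finset {C // IsPeripheralCircle S C}} {b : ℝ≥0∞}
    (hρ : 1 ≤ pathMassSum S ρ γ) (hL : L.card * carpetMass S (fun C => 2 * ρ C) ≤ 1)
    (hb : pathMassSum S (fun C => 2 * ρ C) γ ≤ ∑ C ∈ L, 2 * ρ C.1 + b) : 1 ≤ b := by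
  have hsum : ∑ C ∈ L, 2 * ρ C.1 ≤ 1 := by
    have := (sum_sq_le_card_mul_carpetMass (fun C => 2 * ρ C) L).trans hL
    by_contra! hlt
    exact absurd this (not_le.2 (one_lt_pow₀ hlt two_ne_zero))
  have htwo : (1 : ℝ≥0∞) + 1 ≤ 1 + b :=
    calc (1 : ℝ≥0∞) + 1 = 2 * 1 := by norm_num
      _ ≤ 2 * pathMassSum S ρ γ := by gcongr
      _ = pathMassSum S (fun C => 2 * ρ C) γ := ENNReal.tsum_mul_left.symm
      _ ≤ _ := hb
      _ ≤ 1 + b := by gcongr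
  exact (ENNReal.add_le_add_iff_left ENNReal.one_ne_top).1 htwo

theorem carpetMass_two_mul {S : Set ↥Sphere2} (ρ : Set ↥Sphere2 → ℝ≥0∞) :
    carpetMass S (fun C => 2 * ρ C) = 4 * carpetMass S ρ := by
  simp only [carpetMass, mul_pow, ENNReal.tsum_mul_left]
  norm_num

/-- **Vanishing carpet modulus implies vanishing conformal modulus** (Lemma 2.3).
If `S` is a carpet in `S²` whose peripheral circles are uniform quasicircles and `Γ` is a
path family in `S²` with `mod_S(Γ) = 0`, then `mod(Γ) = 0`. -/
theorem conformalModulus_eq_zero_of_carpetModulus_eq_zero (S : Set ↥Sphere2)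
    (hS : IsCarpet S) (hq : UniformQuasicircles {C | IsPeripheralCircle S C})
    (Γ : Set SpherePath) (h : carpetModulus S Γ = 0) :
    conformalModulus Γ = 0 := by
  obtain ⟨K, hK, G, hG, hL⟩ := exists_density_of_mass hq
  have key : ∀ k : ℕ, conformalModulus Γ ≤ (4 * K + 1) * (k : ℝ≥0∞)⁻¹ := by
    intro k
    have hk : (k : ℝ≥0∞)⁻¹ ≠ 0 := ENNReal.inv_ne_zero.2 (ENNReal.natCast_ne_top k)
    obtain ⟨m, hm, hmsum⟩ := ENNReal.exists_pos_sum_of_countable'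
      (lt_min (pos_iff_ne_zero.2 hk) one_pos).ne' ℕ
    choose ρ hadm hmass using fun n => exists_mass_of_carpetModulus_eq_zero h (hm n)
    choose Γ₀ _ hΓ₀ hpath using hadm
    choose τ hτm hτ hτint using fun n => exists_density_of_conformalModulus_eq_zero (hΓ₀ n) (hm n)
    let g : ℕ → ↥Sphere2 → ℝ≥0∞ := fun n => G fun C => 2 * ρ n C
    have hm0 : Tendsto m atTop (𝓝 0) := ENNReal.tendsto_atTop_zero_of_tsum_ne_top
      ((hmsum.trans_le (min_le_right _ _)).trans ENNReal.one_lt_top).ne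
    calc conformalModulus Γ
        ≤ ∑' n, ∫⁻ y, (max (g n y) (τ n y)) ^ 2 ∂sphereMeasure := by
          refine conformalModulus_le_tsum (fun n y => max (g n y) (τ n y))
            (fun n => (hG _).1.max (hτm n)) fun γ hγ hrect => ?_
          by_cases hex : ∃ n, γ ∈ Γ₀ n
          · obtain ⟨n, hn⟩ := hex
            exact ⟨n, (hτ n γ hn hrect).trans (γ.lineIntegral_mono fun y => le_max_right _ _)⟩
          · push Not at hex
            obtain ⟨L, hLγ⟩ := hL γ hrect
            have hlim : Tendsto (fun n => (L.card : ℝ≥0∞) * (4 * m n)) atTop (𝓝 0) := by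
              simpa using ENNReal.Tendsto.const_mul (ENNReal.Tendsto.const_mul hm0
                (Or.inr (by norm_num : (4 : ℝ≥0∞) ≠ ∞))) (Or.inr (ENNReal.natCast_ne_top L.card))
            obtain ⟨n, hn⟩ := (hlim.eventually_lt_const one_pos).exists
            refine ⟨n, (one_le_of_pathMassSum (hpath n γ ⟨hγ, hex n⟩) ?_ (hLγ _)).trans
              (γ.lineIntegral_mono fun y => le_max_left _ _)⟩
            rw [carpetMass_two_mul]
            refine le_trans ?_ hn.le
            gcongr
            exact (hmass n).le
      _ ≤ ∑' n, (4 * K + 1) * m n := by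
          refine ENNReal.tsum_le_tsum fun n => ?_
          calc ∫⁻ y, (max (g n y) (τ n y)) ^ 2 ∂sphereMeasure
              ≤ ∫⁻ y, (g n y ^ 2 + τ n y ^ 2) ∂sphereMeasure := by
                refine lintegral_mono fun y => ?_
                rcases max_choice (g n y) (τ n y) with hy | hy <;> simp only [hy]
                exacts [le_self_add, le_add_self]
            _ = ∫⁻ y, g n y ^ 2 ∂sphereMeasure + ∫⁻ y, τ n y ^ 2 ∂sphereMeasure :=
                lintegral_add_right _ ((hτm n).pow_const 2)
            _ ≤ K * (4 * m n) + m n := by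
                refine add_le_add ((hG _).2.trans ?_) (hτint n).le
                rw [carpetMass_two_mul]
                gcongr
                exact (hmass n).le
            _ = (4 * K + 1) * m n := by ring
      _ = (4 * K + 1) * ∑' n, m n := ENNReal.tsum_mul_left
      _ ≤ (4 * K + 1) * (k : ℝ≥0∞)⁻¹ := by
          gcongr
          exact hmsum.le.trans (min_le_left _ _)
  have hlim : Tendsto (fun k : ℕ => (4 * K + 1) * (k : ℝ≥0∞)⁻¹) atTop (𝓝 0) := by
    have hne : 4 * K + 1 ≠ ∞ := by finiteness
    simpa using ENNReal.Tendsto.const_mul ENNReal.tendsto_inv_nat_nhds_zero (Or.inr hne)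
  exact le_antisymm (ge_of_tendsto' hlim key) zero_le
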